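/- arXiv:math/0501335 — 5 statements merged into one kernel-verified Lean document; each statement's English description precedes it below -/
import Mathlib

section
/- In the affine nilCoxeter algebra U_n, the elements h_0(u), h_1(u), …, h_{n−1}(u) pairwise commute: h_k(u) h_l(u) = h_l(u) h_k(u) for all 0 ≤ k, l ≤ n−1. -/
open scoped BigOperators

/-- The defining relations of the affine nilCoxeter algebra `U_n`: `uᵢ² = 0`,
the braid relations `uᵢ u_{i+1} uᵢ = u_{i+1} uᵢ u_{i+1}`, and commutation
`uᵢ uⱼ = uⱼ uᵢ` whenever `i - j ≢ ±1 (mod n)`. -/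
inductive NilCoxRel (n : ℕ) : FreeAlgebra ℂ (ZMod n) → FreeAlgebra ℂ (ZMod n) → Prop
  | sq (i : ZMod n) : NilCoxRel n (FreeAlgebra.ι ℂ i * FreeAlgebra.ι ℂ i) 0
  | braid (i : ZMod n) :
      NilCoxRel n (FreeAlgebra.ι ℂ i * FreeAlgebra.ι ℂ (i + 1) * FreeAlgebra.ι ℂ i)
        (FreeAlgebra.ι ℂ (i + 1) * FreeAlgebra.ι ℂ i * FreeAlgebra.ι ℂ (i + 1))
  | comm (i j : ZMod n) (h1 : i - j ≠ 1) (h2 : j - i ≠ 1) :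
      NilCoxRel n (FreeAlgebra.ι ℂ i * FreeAlgebra.ι ℂ j)
        (FreeAlgebra.ι ℂ j * FreeAlgebra.ι ℂ i)

/-- The affine nilCoxeter algebra `U_n`: the quotient of the free associative `ℂ`-algebra
on `u_0, …, u_{n-1}` by the defining relations. -/
abbrev NilCox (n : ℕ) := RingQuot (NilCoxRel n)

/-- The generator `uᵢ` of the affine nilCoxeter algebra. -/
noncomputable def uG (n : ℕ) (i : ZMod n) : NilCox n :=
  RingQuot.mkAlgHom ℂ (NilCoxRel n) (FreeAlgebra.ι ℂ i)

/-- A residue mod `n` not belonging to `A` (the one with least representative), used to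
linearise the cyclic order on `A`. -/
def miss (n : ℕ) (A : Finset (ZMod n)) : ZMod n :=
  ((((List.range n).find? fun k : ℕ => decide (((k : ℕ) : ZMod n) ∉ A)).getD 0 : ℕ) : ZMod n)

/-- `u_A`: the product of the `u_a` for `a ∈ A` in cyclically decreasing order, i.e. an
order in which `i + 1` precedes `i` whenever both lie in `A`. -/
noncomputable def uA (n : ℕ) (A : Finset (ZMod n)) : NilCox n :=
  ((A.toList.insertionSort fun x y => (y - miss n A).val ≤ (x - miss n A).val).map
    (uG n)).prod

/-- The noncommutative homogeneous symmetric function `h_k(u) = ∑_{A ⊆ ℤ/n, |A| = k} u_A`. -/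
noncomputable def hU (n : ℕ) (k : ℕ) : NilCox n :=
  ∑ A ∈ Finset.powersetCard k ((Finset.range n).image (Nat.cast : ℕ → ZMod n)), uA n A


theorem uG_sq (n : ℕ) (i : ZMod n) : uG n i * uG n i = 0 := by
  have := RingQuot.mkAlgHom_rel ℂ (NilCoxRel.sq (n := n) i)
  simpa [uG] using this

theorem uG_braid (n : ℕ) (i : ZMod n) :
    uG n i * uG n (i + 1) * uG n i = uG n (i + 1) * uG n i * uG n (i + 1) := by
  have := RingQuot.mkAlgHom_rel ℂ (NilCoxRel.braid (n := n) i)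
  simpa [uG] using this

theorem uG_comm (n : ℕ) (i j : ZMod n) (h1 : i - j ≠ 1) (h2 : j - i ≠ 1) :
    Commute (uG n i) (uG n j) := by
  have := RingQuot.mkAlgHom_rel ℂ (NilCoxRel.comm (n := n) i j h1 h2)
  simpa [uG, Commute, SemiconjBy] using this

/-- natural number casts in `ZMod n` that are not zero/one -/
theorem cast_ne_one {n : ℕ} (hn : 3 ≤ n) {a : ℕ} (h1 : a < n) (h2 : a ≠ 1) :
    (a : ZMod n) ≠ 1 := by
  intro h
  have h' : (a : ZMod n) = ((1 : ℕ) : ZMod n) := by simpa using h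
  rw [ZMod.natCast_eq_natCast_iff'] at h'
  rw [Nat.mod_eq_of_lt h1, Nat.mod_eq_of_lt (by omega)] at h'
  exact h2 h'

theorem uG_comm_nat {n : ℕ} (hn : 3 ≤ n) (m : ZMod n) {s t : ℕ} (h1 : s + 2 ≤ t)
    (h2 : t + 2 ≤ n + s) : Commute (uG n (m + s)) (uG n (m + t)) := by
  apply uG_comm
  · have : m + (s : ZMod n) - (m + t) = ((n + s - t : ℕ) : ZMod n) := by
      rw [Nat.cast_sub (by omega)]; push_cast; simp
    rw [this]; apply cast_ne_one hn <;> omega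
  · have : m + (t : ZMod n) - (m + s) = ((t - s : ℕ) : ZMod n) := by
      rw [Nat.cast_sub (by omega)]; ring
    rw [this]; apply cast_ne_one hn <;> omega

/-- factor of a set at a site -/
noncomputable def gS (n : ℕ) (S : Finset (ZMod n)) (x : ZMod n) : NilCox n :=
  if x ∈ S then uG n x else 1

/-- decreasing product over the sites `a + L - 1, …, a` of the factors of `S` -/
noncomputable def seg (n : ℕ) (S : Finset (ZMod n)) (a : ZMod n) : ℕ → NilCox n
  | 0 => 1
  | L + 1 => gS n S (a + L) * seg n S a L

/-- decreasing product of all generators at `a + L - 1, …, a` -/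
noncomputable def run (n : ℕ) (a : ZMod n) : ℕ → NilCox n
  | 0 => 1
  | L + 1 => uG n (a + L) * run n a L

theorem seg_add (n : ℕ) (S : Finset (ZMod n)) (a : ZMod n) (L M : ℕ) :
    seg n S a (L + M) = seg n S (a + L) M * seg n S a L := by
  induction M with
  | zero => simp [seg]
  | succ M ih =>
    rw [← add_assoc, seg, ih, seg]
    simp [add_assoc, mul_assoc]

theorem seg_congr (n : ℕ) (S T : Finset (ZMod n)) (a : ZMod n) (L : ℕ)
    (h : ∀ t < L, (a + (t : ZMod n) ∈ S ↔ a + (t : ZMod n) ∈ T)) :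
    seg n S a L = seg n T a L := by
  induction L with
  | zero => rfl
  | succ L ih =>
    rw [seg, seg, ih (fun t ht => h t (by omega))]
    simp only [gS, h L (by omega)]

theorem seg_run (n : ℕ) (S : Finset (ZMod n)) (a : ZMod n) (L : ℕ)
    (h : ∀ t < L, a + (t : ZMod n) ∈ S) : seg n S a L = run n a L := by
  induction L with
  | zero => rfl
  | succ L ih =>
    rw [seg, run, ih (fun t ht => h t (by omega)), gS, if_pos (h L (by omega))]

theorem seg_one (n : ℕ) (S : Finset (ZMod n)) (a : ZMod n) (L : ℕ)
    (h : ∀ t < L, a + (t : ZMod n) ∉ S) : seg n S a L = 1 := by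
  induction L with
  | zero => rfl
  | succ L ih =>
    rw [seg, ih (fun t ht => h t (by omega)), gS, if_neg (h L (by omega)), one_mul]

theorem seg_commute (n : ℕ) (S : Finset (ZMod n)) (a : ZMod n) (L : ℕ) (z : NilCox n)
    (h : ∀ t < L, Commute (gS n S (a + (t : ZMod n))) z) : Commute (seg n S a L) z := by
  induction L with
  | zero => exact Commute.one_left z
  | succ L ih =>
    rw [seg]
    exact (h L (by omega)).mul_left (ih fun t ht => h t (by omega))

theorem run_commute (n : ℕ) (a : ZMod n) (L : ℕ) (z : NilCox n)
    (h : ∀ t < L, Commute (uG n (a + (t : ZMod n))) z) : Commute (run n a L) z := by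
  induction L with
  | zero => exact Commute.one_left z
  | succ L ih =>
    rw [run]
    exact (h L (by omega)).mul_left (ih fun t ht => h t (by omega))

theorem run_succ' (n : ℕ) (a : ZMod n) (L : ℕ) :
    run n a (L + 1) = run n (a + 1) L * uG n a := by
  induction L with
  | zero => simp [run]
  | succ L ih =>
    rw [run, ih, run, mul_assoc]
    congr 2
    push_cast; ring

theorem run_exchange {n : ℕ} (hn : 3 ≤ n) (a : ZMod n) (L : ℕ) (hL : L + 1 < n) :
    run n a (L + 1) * run n (a + 1) L = run n a L * run n a (L + 1) := by
  induction L with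
  | zero => simp [run]
  | succ L ih =>
    have ih := ih (by omega)
    have hc : Commute (run n a L) (uG n (a + ((L + 1 : ℕ) : ZMod n))) :=
      run_commute n a L _ fun t ht => uG_comm_nat hn a (by omega) (by omega)
    have hb := uG_braid n (a + (L : ZMod n))
    have e1 : a + (L : ZMod n) + 1 = a + ((L + 1 : ℕ) : ZMod n) := by push_cast; ring
    have e2 : a + 1 + (L : ZMod n) = a + ((L + 1 : ℕ) : ZMod n) := by push_cast; ring
    rw [e1] at hb
    have hs : run n (a + 1) (L + 1) = uG n (a + ((L + 1 : ℕ) : ZMod n)) * run n (a + 1) L := by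
      rw [run, e2]
    have h2 : run n a (L + 1 + 1) = uG n (a + ((L + 1 : ℕ) : ZMod n)) * run n a (L + 1) := rfl
    have h1 : run n a (L + 1) = uG n (a + (L : ZMod n)) * run n a L := rfl
    rw [hs, h2]
    generalize uG n (a + ((L + 1 : ℕ) : ZMod n)) = v at *
    calc v * run n a (L + 1) * (v * run n (a + 1) L)
        = v * uG n (a + (L : ZMod n)) * (run n a L * v) * run n (a + 1) L := by
          rw [h1]; simp only [mul_assoc]
      _ = (v * uG n (a + (L : ZMod n)) * v) * run n a L * run n (a + 1) L := by
          rw [hc.eq]; simp only [mul_assoc]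
      _ = uG n (a + (L : ZMod n)) * v * (run n a (L + 1) * run n (a + 1) L) := by
          rw [← hb, h1]; simp only [mul_assoc]
      _ = uG n (a + (L : ZMod n)) * (v * run n a L) * run n a (L + 1) := by
          rw [ih]; simp only [mul_assoc]
      _ = run n a (L + 1) * (v * run n a (L + 1)) := by
          rw [← hc.eq]; nth_rewrite 2 [h1]; simp only [mul_assoc]

theorem run_sq {n : ℕ} (hn : 3 ≤ n) (a : ZMod n) (L : ℕ) (hL : L + 1 < n) :
    run n a (L + 1) * run n a (L + 1) = 0 := by
  nth_rewrite 2 [run_succ']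
  rw [← mul_assoc, run_exchange hn a L hL, run_succ', mul_assoc, mul_assoc, uG_sq]
  simp

theorem gS_not (n : ℕ) (S : Finset (ZMod n)) (x : ZMod n) (h : x ∉ S) : gS n S x = 1 := by
  simp [gS, h]

theorem gS_commute_nat {n : ℕ} (hn : 3 ≤ n) (S : Finset (ZMod n)) (m : ZMod n) {s t : ℕ}
    (h1 : s + 2 ≤ t) (h2 : t + 2 ≤ n + s) : Commute (gS n S (m + s)) (gS n S (m + t)) := by
  unfold gS
  split_ifs
  · exact uG_comm_nat hn m h1 h2
  · exact Commute.one_right _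
  · exact Commute.one_left _
  · exact Commute.one_left _

theorem seg_base {n : ℕ} (hn : 3 ≤ n) (S : Finset (ZMod n)) (m m' : ZMod n)
    (h : m ∉ S) (h' : m' ∉ S) : seg n S m n = seg n S m' n := by
  have : NeZero n := ⟨by omega⟩
  obtain ⟨r, hr, rfl⟩ : ∃ r : ℕ, r < n ∧ m' = m + r :=
    ⟨(m' - m).val, ZMod.val_lt _, by simp⟩
  have e1 : seg n S m n = seg n S (m + r) (n - r) * seg n S m r := by
    rw [← seg_add]; congr 1; omega
  have e2 : seg n S (m + r) n = seg n S m r * seg n S (m + r) (n - r) := by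
    have := seg_add n S (m + r) (n - r) r
    rw [show n - r + r = n by omega] at this
    rw [this]
    congr 2
    rw [Nat.cast_sub (by omega)]; simp
  rw [e1, e2]
  symm
  apply seg_commute
  intro s hs
  symm
  apply seg_commute
  intro t ht
  symm
  rcases Nat.eq_zero_or_pos s with rfl | hs0
  · rw [gS_not n S (m + _) (by simpa using h)]; exact Commute.one_left _
  rcases Nat.eq_zero_or_pos t with rfl | ht0
  · rw [gS_not n S (m + _ + _) (by simpa using h')]; exact Commute.one_right _
  have : m + (r : ZMod n) + t = m + ((r + t : ℕ) : ZMod n) := by push_cast; ring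
  rw [this]
  exact gS_commute_nat hn S m (by omega) (by omega)

theorem miss_not_mem {n : ℕ} (hn : 3 ≤ n) (S : Finset (ZMod n)) (h : ∃ x, x ∉ S) :
    miss n S ∉ S := by
  have : NeZero n := ⟨by omega⟩
  unfold miss
  cases hf : (List.range n).find? fun k : ℕ => decide (((k : ℕ) : ZMod n) ∉ S) with
  | none =>
    exfalso
    obtain ⟨x, hx⟩ := h
    rw [List.find?_eq_none] at hf
    have := hf x.val (by simpa using ZMod.val_lt x)
    simp at this
    exact hx this
  | some k =>
    have := List.find?_some hf
    simpa using this

theorem seg_list (n : ℕ) (S : Finset (ZMod n)) (m : ZMod n) (L : ℕ) :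
    seg n S m L = ((((List.range L).reverse.map (fun t : ℕ => m + (t : ZMod n))).filter
      (fun x => decide (x ∈ S))).map (uG n)).prod := by
  induction L with
  | zero => simp [seg]
  | succ L ih =>
    rw [seg, ih, List.range_succ, List.reverse_append]
    simp only [List.reverse_singleton, List.singleton_append, List.map_cons, List.filter_cons]
    by_cases h : m + (L : ZMod n) ∈ S
    · simp [gS, h]
    · simp [gS, h]

theorem uA_eq_seg {n : ℕ} (hn : 3 ≤ n) (S : Finset (ZMod n)) (m : ZMod n) (h : m ∉ S) :
    uA n S = seg n S m n := by
  have : NeZero n := ⟨by omega⟩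
  rw [seg_base hn S m (miss n S) h (miss_not_mem hn S ⟨m, h⟩), seg_list, uA]
  congr 2
  generalize miss n S = c
  have hval : ∀ t < n, (c + (t : ZMod n) - c).val = t := by
    intro t ht
    rw [add_sub_cancel_left, ZMod.val_natCast, Nat.mod_eq_of_lt ht]
  have ha : Std.Antisymm (fun x y : ZMod n => (y - c).val ≤ (x - c).val) :=
    ⟨fun x y h1 h2 => by
      have := ZMod.val_injective n (le_antisymm h2 h1)
      simpa using this⟩
  have : Std.Total (fun x y : ZMod n => (y - c).val ≤ (x - c).val) :=
    ⟨fun x y => le_total _ _⟩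
  have : IsTrans (ZMod n) (fun x y : ZMod n => (y - c).val ≤ (x - c).val) :=
    ⟨fun x y z h1 h2 => le_trans h2 h1⟩
  have hnd : ((List.range n).reverse.map (fun t : ℕ => c + (t : ZMod n))).Nodup := by
    apply List.Nodup.map_on
    · intro x hx y hy hxy
      simp at hx hy
      rw [← hval x hx, ← hval y hy, hxy]
    · exact List.nodup_reverse.2 List.nodup_range
  refine List.Perm.eq_of_pairwise (le := fun x y : ZMod n => (y - c).val ≤ (x - c).val)
    (fun a b _ _ h1 h2 => ha.antisymm a b h1 h2)
    (List.pairwise_insertionSort _ _) ?_ ?_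
  · apply List.Pairwise.filter
    rw [List.pairwise_map, List.pairwise_reverse]
    refine List.Pairwise.imp_of_mem ?_ (List.pairwise_lt_range (n := n))
    intro a b hA hB hab
    simp at hA hB
    rw [hval a hA, hval b hB]; omega
  · refine (List.perm_insertionSort _ _).trans ?_
    rw [List.perm_ext_iff_of_nodup (Finset.nodup_toList _) (hnd.filter _)]
    intro x
    simp only [Finset.mem_toList, List.mem_filter, decide_eq_true_eq, List.mem_map,
      List.mem_reverse, List.mem_range]
    refine ⟨fun hx => ⟨⟨(x - c).val, ZMod.val_lt _, by simp⟩, hx⟩, fun hx => hx.2⟩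

/-- split a run off on the right -/
theorem uA_split_right {n : ℕ} (hn : 3 ≤ n) (S : Finset (ZMod n)) (i : ZMod n) (L : ℕ)
    (hL : L < n) (h0 : i ∉ S) (h : ∀ t < L, i + 1 + (t : ZMod n) ∈ S) :
    uA n S = seg n S (i + 1 + L) (n - 1 - L) * run n (i + 1) L := by
  have key := seg_add n S i (1 + L) (n - 1 - L)
  rw [show 1 + L + (n - 1 - L) = n by omega, seg_add] at key
  rw [uA_eq_seg hn S i h0, key]
  rw [seg_one n S i 1 (by intro t ht; obtain rfl : t = 0 := by omega
                          simpa using h0)]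
  rw [mul_one]
  push_cast
  rw [seg_run n S (i + 1) L h]
  simp [add_assoc]

/-- split a run off on the left; `b` is the start of the run -/
theorem uA_split_left {n : ℕ} (hn : 3 ≤ n) (S : Finset (ZMod n)) (b : ZMod n) (L : ℕ)
    (hL : L < n) (h0 : b + (L : ZMod n) ∉ S) (h : ∀ t < L, b + (t : ZMod n) ∈ S) :
    uA n S = run n b L * seg n S (b + L) (n - L) := by
  have key := seg_add n S (b + (L : ZMod n)) (n - L) L
  have e : b + (L : ZMod n) + ((n - L : ℕ) : ZMod n) = b := by
    rw [Nat.cast_sub (by omega)]; simp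
  rw [e, show n - L + L = n by omega] at key
  rw [uA_eq_seg hn S _ h0, key, seg_run n S b L h]

/-- the complement of `Q + 1` -/
def BB (n : ℕ) [NeZero n] (Q : Finset (ZMod n)) : Finset (ZMod n) :=
  Finset.univ.filter fun x => x - 1 ∉ Q

/-- the product attached to a pair `(P, Q)` -/
noncomputable def WW (n : ℕ) [NeZero n] (P Q : Finset (ZMod n)) : NilCox n :=
  uA n Pᶜ * uA n (BB n Q)

theorem mem_BB {n : ℕ} [NeZero n] (Q : Finset (ZMod n)) (x : ZMod n) :
    x + 1 ∈ BB n Q ↔ x ∉ Q := by simp [BB]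

theorem add_cast_ne {n : ℕ} [NeZero n] (x : ZMod n) {s t : ℕ} (hs : s < n) (ht : t < n)
    (h : s ≠ t) : x + (s : ZMod n) ≠ x + t := by
  intro h'
  have h' := add_left_cancel h'
  rw [ZMod.natCast_eq_natCast_iff', Nat.mod_eq_of_lt hs, Nat.mod_eq_of_lt ht] at h'
  exact h h'

theorem WW_bad {n : ℕ} [NeZero n] (hn : 3 ≤ n) (P Q : Finset (ZMod n)) (x : ZMod n) (L : ℕ)
    (hL : L + 1 < n) (h1 : x ∈ P) (h2 : x ∉ Q) (h3 : x + 1 + L ∉ P) (h4 : x + 1 + L ∈ Q)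
    (h5 : ∀ t < L, x + 1 + (t : ZMod n) ∉ P) (h6 : ∀ t < L, x + 1 + (t : ZMod n) ∉ Q) :
    WW n P Q = 0 := by
  have hA : ∀ t < L + 1, x + 1 + (t : ZMod n) ∈ Pᶜ := by
    intro t ht
    rw [Finset.mem_compl]
    rcases Nat.lt_succ_iff_lt_or_eq.1 ht with h | rfl
    · exact h5 t h
    · exact h3
  have hB : ∀ t < L + 1, x + 1 + (t : ZMod n) ∈ BB n Q := by
    intro t ht
    rcases t with _ | t
    · simpa [mem_BB] using h2
    · have := h6 t (by omega)
      rw [← mem_BB] at this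
      convert this using 1
      push_cast; ring
  rw [WW, uA_split_right hn _ x (L + 1) (by omega) (by simpa using h1) hA,
    uA_split_left hn _ (x + 1) (L + 1) (by omega) ?_ hB]
  · rw [mul_assoc, ← mul_assoc (run n _ _), run_sq hn _ _ hL]; simp
  · have h4 : x + 1 + (L : ZMod n) + 1 ∉ BB n Q := by rw [mem_BB]; simpa using h4
    convert h4 using 2
    push_cast; ring

theorem WW_flip {n : ℕ} [NeZero n] (hn : 3 ≤ n) (P Q : Finset (ZMod n)) (x : ZMod n) (L : ℕ)
    (hL : L + 1 < n) (h1 : x ∈ P) (h2 : x ∈ Q) (h3 : x + 1 + L ∉ P) (h4 : x + 1 + L ∈ Q)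
    (h5 : ∀ t < L, x + 1 + (t : ZMod n) ∉ P) (h6 : ∀ t < L, x + 1 + (t : ZMod n) ∉ Q) :
    WW n P Q = WW n (insert (x + 1 + (L : ZMod n)) P) (Q.erase x) := by
  have hA : ∀ t < L + 1, x + 1 + (t : ZMod n) ∈ Pᶜ := by
    intro t ht
    rw [Finset.mem_compl]
    rcases Nat.lt_succ_iff_lt_or_eq.1 ht with h | rfl
    · exact h5 t h
    · exact h3
  have hA' : ∀ t < L, x + 1 + (t : ZMod n) ∈ (insert (x + 1 + (L : ZMod n)) P)ᶜ := by
    intro t ht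
    rw [Finset.mem_compl, Finset.mem_insert, not_or]
    exact ⟨add_cast_ne _ (by omega) (by omega) (by omega), h5 t ht⟩
  have hB : ∀ t < L, x + 1 + 1 + (t : ZMod n) ∈ BB n Q := by
    intro t ht
    have := h6 t ht
    rw [← mem_BB] at this
    convert this using 1
    ring
  have hB' : ∀ t < L + 1, x + 1 + (t : ZMod n) ∈ BB n (Q.erase x) := by
    intro t ht
    rcases t with _ | t
    · simp [mem_BB]
    · have := h6 t (by omega)
      have : x + 1 + (t : ZMod n) ∉ Q.erase x := fun h => this (Finset.mem_of_mem_erase h)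
      rw [← mem_BB] at this
      convert this using 1
      push_cast; ring
  have hx : x + 1 + (L : ZMod n) ≠ x := by
    have := add_cast_ne x (s := 1 + L) (t := 0) (by omega) (by omega) (by omega)
    push_cast at this
    simpa [add_assoc] using this
  have q1 : x + 1 + (L : ZMod n) + 1 ∉ BB n Q := by rw [mem_BB]; simpa using h4
  have q2 : x + 1 + (L : ZMod n) + 1 ∉ BB n (Q.erase x) := by
    rw [mem_BB]; simpa using ⟨hx, h4⟩
  have r1 : x + 1 + 1 + (L : ZMod n) = x + 1 + (L : ZMod n) + 1 := by ring
  have r2 : x + 1 + ((L + 1 : ℕ) : ZMod n) = x + 1 + (L : ZMod n) + 1 := by push_cast; ring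
  rw [WW, WW, uA_split_right hn _ x (L + 1) (by omega) (by simpa using h1) hA,
    uA_split_right hn _ x L (by omega) (by simp [h1]) hA',
    uA_split_left hn _ (x + 1 + 1) L (by omega) (by rw [r1]; exact q1) hB,
    uA_split_left hn _ (x + 1) (L + 1) (by omega) (by rw [r2]; exact q2) hB', r1, r2]
  have s1 : seg n (insert (x + 1 + (L : ZMod n)) P)ᶜ (x + 1 + L) (n - 1 - L)
      = seg n Pᶜ (x + 1 + L + 1) (n - 1 - (L + 1)) := by
    rw [show n - 1 - L = 1 + (n - 1 - (L + 1)) by omega, seg_add]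
    rw [seg_one n _ _ 1 (by intro t ht; obtain rfl : t = 0 := by omega
                            simp), mul_one]
    push_cast
    apply seg_congr
    intro t ht
    have := add_cast_ne (x + 1 + (L : ZMod n)) (s := 1 + t) (t := 0) (by omega) (by omega) (by omega)
    push_cast at this
    rw [← add_assoc, add_zero] at this
    simp [this]
  have s2 : seg n (BB n Q) (x + 1 + L + 1) (n - L)
      = seg n (BB n (Q.erase x)) (x + 1 + L + 1) (n - (L + 1)) := by
    rw [show n - L = (n - (L + 1)) + 1 by omega, seg]
    have : x + 1 + (L : ZMod n) + 1 + ((n - (L + 1) : ℕ) : ZMod n) = x + 1 := by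
      rw [Nat.cast_sub (by omega)]; push_cast; simp
    rw [this, gS_not _ _ _ (by rw [mem_BB]; simpa using h2), one_mul]
    apply seg_congr
    intro t ht
    have e : x + 1 + (L : ZMod n) + 1 + (t : ZMod n) = x + ((1 + L + t : ℕ) : ZMod n) + 1 := by
      push_cast; ring
    have := add_cast_ne x (s := 1 + L + t) (t := 0) (by omega) (by omega) (by omega)
    rw [Nat.cast_zero, add_zero] at this
    rw [e, mem_BB, mem_BB, Finset.mem_erase]
    exact ⟨fun h h' => h h'.2, fun h h' => h ⟨this, h'⟩⟩
  rw [s1, s2, mul_assoc, mul_assoc, ← mul_assoc (run n _ _), run_exchange hn _ _ hL, mul_assoc]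

/-- backward distance to `S` -/
noncomputable def dst (n : ℕ) (S : Finset (ZMod n)) (x : ZMod n) : ℕ :=
  sInf {m : ℕ | 1 ≤ m ∧ x - (m : ZMod n) ∈ S}

/-- the previous element of `S` -/
noncomputable def pv (n : ℕ) (S : Finset (ZMod n)) (x : ZMod n) : ZMod n := x - dst n S x

theorem dst_spec {n : ℕ} [NeZero n] {S : Finset (ZMod n)} (hS : S.Nonempty) (x : ZMod n) :
    1 ≤ dst n S x ∧ pv n S x ∈ S := by
  have : dst n S x ∈ {m : ℕ | 1 ≤ m ∧ x - (m : ZMod n) ∈ S} := by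
    apply Nat.sInf_mem
    obtain ⟨y, hy⟩ := hS
    refine ⟨(x - y).val + n, ?_, ?_⟩
    · have := NeZero.pos n; omega
    · simpa using hy
  exact this

theorem dst_le {n : ℕ} {S : Finset (ZMod n)} {x : ZMod n} {m : ℕ} (hm : 1 ≤ m)
    (h : x - (m : ZMod n) ∈ S) : dst n S x ≤ m := Nat.sInf_le ⟨hm, h⟩

theorem pv_add {n : ℕ} (S : Finset (ZMod n)) (x : ZMod n) : pv n S x + dst n S x = x := by
  simp [pv]

theorem dst_le_n {n : ℕ} [NeZero n] {S : Finset (ZMod n)} (hS : S.Nonempty) (x : ZMod n) :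
    dst n S x ≤ n := by
  obtain ⟨y, hy⟩ := hS
  by_cases h : (x - y).val = 0
  · apply dst_le (NeZero.pos n)
    rw [ZMod.val_eq_zero] at h
    have : x = y := by simpa [sub_eq_zero] using h
    simpa [this] using hy
  · refine (dst_le (m := (x - y).val) (by omega) (by simpa using hy)).trans (ZMod.val_lt _).le

theorem dst_lt_n {n : ℕ} [NeZero n] {S : Finset (ZMod n)} (hS : S.Nonempty) (x : ZMod n)
    (h : pv n S x ≠ x) : dst n S x < n := by
  refine lt_of_le_of_ne (dst_le_n hS x) fun h' => h ?_
  simp [pv, h']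

theorem pv_inj {n : ℕ} [NeZero n] {S : Finset (ZMod n)} {x y : ZMod n}
    (hx : x ∈ S) (hy : y ∈ S) (h : pv n S x = pv n S y) : x = y := by
  have hS : S.Nonempty := ⟨x, hx⟩
  wlog hle : dst n S x ≤ dst n S y generalizing x y
  · exact (this hy hx h.symm (le_of_not_ge hle)).symm
  have hx1 := pv_add S x
  have hy1 := pv_add S y
  rcases hle.eq_or_lt with he | hlt
  · rw [← hx1, ← hy1, h, he]
  · exfalso
    have := dst_le (S := S) (x := y) (m := dst n S y - dst n S x) (by omega) (by
      rw [Nat.cast_sub hle]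
      have : y - ((dst n S y : ZMod n) - dst n S x) = x := by
        linear_combination hx1 - hy1 - h
      rw [this]; exact hx)
    have := (dst_spec hS x).1
    omega

theorem pv_surj {n : ℕ} [NeZero n] {S : Finset (ZMod n)} {x : ZMod n} (hx : x ∈ S) :
    ∃ y ∈ S, pv n S y = x := by
  have := Finset.surj_on_of_inj_on_of_card_le (s := S) (t := S) (fun a _ => pv n S a)
    (fun a _ => (dst_spec ⟨x, hx⟩ a).2) (fun a b ha hb h => pv_inj ha hb h) le_rfl x hx
  obtain ⟨y, hy, h⟩ := this
  exact ⟨y, hy, h.symm⟩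

/-- no elements of `S` strictly between `pv S x` and `x` -/
theorem between {n : ℕ} [NeZero n] {S : Finset (ZMod n)} {x : ZMod n} {t : ℕ}
    (h : t + 1 < dst n S x) : pv n S x + 1 + (t : ZMod n) ∉ S := by
  intro h'
  have := dst_le (S := S) (x := x) (m := dst n S x - (t + 1)) (by omega) (by
    convert h' using 1
    rw [Nat.cast_sub (by omega), pv]; push_cast; ring)
  omega

theorem WW_bad' {n : ℕ} [NeZero n] (hn : 3 ≤ n) (P Q : Finset (ZMod n)) (e : ZMod n)
    (he : e ∈ P ∪ Q) (h1 : e ∉ P) (h2 : pv n (P ∪ Q) e ∉ Q) : WW n P Q = 0 := by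
  have hne : (P ∪ Q).Nonempty := ⟨e, he⟩
  obtain ⟨hd, hm⟩ := dst_spec hne e
  have heQ : e ∈ Q := by simpa [h1] using he
  have hpP : pv n (P ∪ Q) e ∈ P := by simpa [h2] using hm
  have hlt := dst_lt_n hne e (fun h => h1 (h ▸ hpP))
  obtain ⟨L, hL⟩ : ∃ L, dst n (P ∪ Q) e = L + 1 := ⟨dst n (P ∪ Q) e - 1, by omega⟩
  have hend : pv n (P ∪ Q) e + 1 + (L : ZMod n) = e := by
    have := pv_add (P ∪ Q) e
    rw [hL] at this; rw [← this]; push_cast; simp [pv, hL]; ring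
  have hb : ∀ t < L, pv n (P ∪ Q) e + 1 + (t : ZMod n) ∉ P ∪ Q := fun t ht =>
    between (by omega)
  refine WW_bad hn P Q (pv n (P ∪ Q) e) L (by omega) hpP h2 (by rwa [hend]) (by rwa [hend])
    (fun t ht h => hb t ht (Finset.mem_union_left _ h))
    (fun t ht h => hb t ht (Finset.mem_union_right _ h))

theorem WW_flip' {n : ℕ} [NeZero n] (hn : 3 ≤ n) (P Q : Finset (ZMod n)) (e : ZMod n)
    (he : e ∈ P ∪ Q) (h1 : e ∉ P) (h2 : pv n (P ∪ Q) e ∈ Q) (h3 : pv n (P ∪ Q) e ∈ P) :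
    WW n P Q = WW n (insert e P) (Q.erase (pv n (P ∪ Q) e)) := by
  have hne : (P ∪ Q).Nonempty := ⟨e, he⟩
  obtain ⟨hd, hm⟩ := dst_spec hne e
  have heQ : e ∈ Q := by simpa [h1] using he
  have hlt := dst_lt_n hne e (fun h => h1 (h ▸ h3))
  obtain ⟨L, hL⟩ : ∃ L, dst n (P ∪ Q) e = L + 1 := ⟨dst n (P ∪ Q) e - 1, by omega⟩
  have hend : pv n (P ∪ Q) e + 1 + (L : ZMod n) = e := by
    have := pv_add (P ∪ Q) e
    rw [hL] at this; rw [← this]; push_cast; simp [pv, hL]; ring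
  have hb : ∀ t < L, pv n (P ∪ Q) e + 1 + (t : ZMod n) ∉ P ∪ Q := fun t ht =>
    between (by omega)
  have := WW_flip hn P Q (pv n (P ∪ Q) e) L (by omega) h3 h2 (by rwa [hend]) (by rwa [hend])
    (fun t ht h => hb t ht (Finset.mem_union_left _ h))
    (fun t ht h => hb t ht (Finset.mem_union_right _ h))
  rwa [hend] at this

theorem dst_step {n : ℕ} [NeZero n] {S C : Finset (ZMod n)} (hS : S.Nonempty) (hSC : S ⊆ C)
    (e : ZMod n) (h : pv n C e ∉ S) :
    dst n S e = dst n C e + dst n S (pv n C e) ∧ pv n S e = pv n S (pv n C e) := by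
  have hC : C.Nonempty := hS.mono hSC
  obtain ⟨h1, h2⟩ := dst_spec hS e
  obtain ⟨h3, h4⟩ := dst_spec hC e
  obtain ⟨h5, h6⟩ := dst_spec hS (pv n C e)
  have hle : dst n C e ≤ dst n S e := dst_le h1 (hSC h2)
  have hne : dst n C e ≠ dst n S e := by
    intro h'
    apply h
    rw [pv, h']; exact h2
  have a1 : dst n S (pv n C e) ≤ dst n S e - dst n C e := by
    apply dst_le (by omega)
    convert h2 using 1
    rw [Nat.cast_sub hle, pv, pv]; ring
  have a2 : dst n S e ≤ dst n C e + dst n S (pv n C e) := by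
    apply dst_le (by omega)
    convert h6 using 1
    simp only [pv]; push_cast; ring
  have a3 : dst n S e = dst n C e + dst n S (pv n C e) := by omega
  refine ⟨a3, ?_⟩
  rw [pv, a3]
  simp only [pv]; push_cast; ring

/-- no vanishing block -/
def Good (n : ℕ) (P Q : Finset (ZMod n)) : Prop :=
  ∀ e ∈ P ∪ Q, e ∈ P ∨ pv n (P ∪ Q) e ∈ Q

/-- ends of the blocks cut on both sides -/
noncomputable def GG (n : ℕ) (P Q : Finset (ZMod n)) : Finset (ZMod n) :=
  P.filter fun e => pv n (P ∪ Q) e ∈ Q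

theorem WW_canon {n : ℕ} [NeZero n] (hn : 3 ≤ n) (C G : Finset (ZMod n)) (N : ℕ) :
    ∀ P Q : Finset (ZMod n), P.Nonempty → P ∪ Q = C → Good n P Q → GG n P Q = G →
      (C \ P).card = N → WW n P Q = WW n C (G.image (pv n C)) := by
  induction N with
  | zero =>
    intro P Q hP hC hg hG h0
    have hPC : P = C := by
      apply Finset.Subset.antisymm
      · rw [← hC]; exact Finset.subset_union_left
      · rwa [Finset.card_eq_zero, Finset.sdiff_eq_empty_iff_subset] at h0
    have hQ : Q = G.image (pv n C) := by
      ext q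
      rw [Finset.mem_image, ← hG]
      simp only [GG, Finset.mem_filter]
      rw [hC]
      constructor
      · intro hq
        obtain ⟨y, hy, rfl⟩ := pv_surj (S := C) (x := q) (by rw [← hC]; simp [hq])
        exact ⟨y, ⟨hPC ▸ hy, hq⟩, rfl⟩
      · rintro ⟨e, ⟨_, h⟩, rfl⟩; exact h
    rw [← hQ, hPC]
  | succ N ih =>
    intro P Q hP hC hg hG h0
    have hne : (C \ P).Nonempty := by rw [← Finset.card_pos]; omega
    obtain ⟨e, he, hmin⟩ := Finset.exists_min_image (C \ P) (dst n P) hne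
    have hPC : P ⊆ C := by rw [← hC]; exact Finset.subset_union_left
    have hCn : C.Nonempty := hP.mono hPC
    rw [Finset.mem_sdiff] at he
    have hpC := (dst_spec hCn e).2
    have hpP : pv n C e ∈ P := by
      by_contra hcon
      have := (dst_step hP hPC e hcon).1
      have h2 := hmin (pv n C e) (by simp [hpC, hcon])
      have h3 := (dst_spec hCn e).1
      omega
    have hpQ : pv n C e ∈ Q := by
      have := hg e (by rw [hC]; exact he.1)
      rw [hC] at this
      exact this.resolve_left he.2
    have heQ : e ∈ Q := by
      have := he.1
      rw [← hC, Finset.mem_union] at this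
      exact this.resolve_left he.2
    have hne' : e ≠ pv n C e := fun h => he.2 (h ▸ hpP)
    have hfl := WW_flip' hn P Q e (by rw [hC]; exact he.1) he.2 (by rwa [hC]) (by rwa [hC])
    rw [hC] at hfl
    rw [hfl]
    have hC' : insert e P ∪ Q.erase (pv n C e) = C := by
      ext x
      rw [← hC] at hpP hne' ⊢
      simp only [Finset.mem_union, Finset.mem_insert, Finset.mem_erase]
      constructor
      · rintro ((rfl | h) | h)
        · exact Or.inr heQ
        · exact Or.inl h
        · exact Or.inr h.2
      · rintro (h | h)
        · exact Or.inl (Or.inr h)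
        · by_cases hx : x = pv n (P ∪ Q) e
          · exact Or.inl (Or.inr (hx ▸ hpP))
          · exact Or.inr ⟨hx, h⟩
    apply ih _ _ (Finset.insert_nonempty _ _) hC'
    · intro f hf
      rw [hC'] at hf ⊢
      by_cases hfe : f = e
      · left; simp [hfe]
      · rcases hg f (by rwa [hC]) with h | h
        · left; simp [h]
        · right
          rw [hC] at h
          rw [Finset.mem_erase]
          exact ⟨fun h' => hfe (pv_inj hf he.1 h'), h⟩
    · rw [← hG]
      ext f
      simp only [GG, Finset.mem_filter]
      rw [hC', hC, Finset.mem_insert, Finset.mem_erase]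
      constructor
      · rintro ⟨rfl | h, h1, h2⟩
        · exact absurd rfl h1
        · exact ⟨h, h2⟩
      · rintro ⟨h1, h2⟩
        refine ⟨Or.inr h1, fun h' => ?_, h2⟩
        exact he.2 (pv_inj (hPC h1) he.1 h' ▸ h1)
    · have : C \ insert e P = (C \ P).erase e := by
        ext x; simp only [Finset.mem_sdiff, Finset.mem_insert, Finset.mem_erase]; tauto
      rw [this, Finset.card_erase_of_mem (by simp [he.1, he.2]), h0]; rfl

theorem GG_nonempty {n : ℕ} [NeZero n] {P Q : Finset (ZMod n)} (hP : P.Nonempty)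
    (hQ : Q.Nonempty) : (GG n P Q).Nonempty := by
  by_contra hcon
  have hPC : P ⊆ P ∪ Q := Finset.subset_union_left
  have hQC : Q ⊆ P ∪ Q := Finset.subset_union_right
  obtain ⟨e, he, hmin⟩ := Finset.exists_min_image P (dst n Q) hP
  have h1 : pv n (P ∪ Q) e ∉ Q := by
    intro h
    exact hcon ⟨e, by simp [GG, he, h]⟩
  have h2 := dst_spec (hP.mono hPC) e
  have h3 : pv n (P ∪ Q) e ∈ P := by
    have := h2.2
    rw [Finset.mem_union] at this
    exact this.resolve_right h1
  have h4 := (dst_step hQ hQC e h1).1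
  have h5 := hmin _ h3
  have h6 := h2.1
  omega

section chains

variable {α β : Type*} [DecidableEq α] [DecidableEq β]

/-- lower sets in a disjoint union of chains -/
def Low (X : Finset α) (c : α → β) (d : α → ℕ) (I : Finset α) : Prop :=
  ∀ x ∈ X, ∀ y ∈ I, c x = c y → d x < d y → x ∈ I

theorem exists_low (Y : Finset α) (d : α → ℕ)
    (hd : ∀ x ∈ Y, ∀ y ∈ Y, d x = d y → x = y) (p : ℕ) (hp : p ≤ Y.card) :
    ∃ K ⊆ Y, K.card = p ∧ ∀ x ∈ Y, ∀ y ∈ K, d x < d y → x ∈ K := by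
  induction p with
  | zero => exact ⟨∅, by simp, by simp, by simp⟩
  | succ p ih =>
    obtain ⟨K, hK, hc, hl⟩ := ih (by omega)
    have hne : (Y \ K).Nonempty := by
      rw [← Finset.card_pos, Finset.card_sdiff_of_subset hK]; omega
    obtain ⟨e, he, hmin⟩ := Finset.exists_min_image (Y \ K) d hne
    rw [Finset.mem_sdiff] at he
    refine ⟨insert e K, Finset.insert_subset he.1 hK, ?_, ?_⟩
    · rw [Finset.card_insert_of_notMem he.2, hc]
    · intro x hx y hy hxy
      by_cases hxK : x ∈ K
      · simp [hxK]
      rw [Finset.mem_insert] at hy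
      rcases hy with rfl | hy
      · have := hmin x (by simp [hx, hxK]); omega
      · exact absurd (hl x hx y hy hxy) hxK

theorem low_subset {X : Finset α} {c : α → β} {d : α → ℕ}
    (hd : ∀ x ∈ X, ∀ y ∈ X, c x = c y → d x = d y → x = y) {I J : Finset α}
    (hI : I ⊆ X) (hJ : J ⊆ X) (lI : Low X c d I) (lJ : Low X c d J)
    (h : ∀ b, (I.filter (c · = b)).card = (J.filter (c · = b)).card) : I ⊆ J := by
  intro x hx
  by_contra hxJ
  have : J.filter (c · = c x) ⊂ I.filter (c · = c x) := by
    rw [Finset.ssubset_iff_of_subset]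
    · exact ⟨x, by simp [hx], by simp [hxJ]⟩
    · intro y hy
      rw [Finset.mem_filter] at hy ⊢
      refine ⟨?_, hy.2⟩
      rcases lt_trichotomy (d y) (d x) with h1 | h1 | h1
      · exact lI y (hJ hy.1) x hx hy.2 h1
      · exact absurd (hd y (hJ hy.1) x (hI hx) hy.2 h1 ▸ hy.1) hxJ
      · exact absurd (lJ x (hI hx) y hy.1 hy.2.symm h1) hxJ
  have := Finset.card_lt_card this
  rw [h] at this
  omega

theorem exists_compl_low {X : Finset α} {c : α → β} {d : α → ℕ}
    (hd : ∀ x ∈ X, ∀ y ∈ X, c x = c y → d x = d y → x = y) {I : Finset α}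
    (hI : I ⊆ X) : ∃ J ⊆ X, Low X c d J ∧
      ∀ b, (I.filter (c · = b)).card + (J.filter (c · = b)).card
        = (X.filter (c · = b)).card := by
  have key : ∀ b, ∃ K ⊆ X.filter (c · = b),
      K.card = (X.filter (c · = b)).card - (I.filter (c · = b)).card ∧
      ∀ x ∈ X.filter (c · = b), ∀ y ∈ K, d x < d y → x ∈ K := by
    intro b
    apply exists_low
    · intro x hx y hy h
      rw [Finset.mem_filter] at hx hy
      exact hd x hx.1 y hy.1 (hx.2.trans hy.2.symm) h
    · omega
  choose K hK hc hl using key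
  refine ⟨X.filter fun x => x ∈ K (c x), Finset.filter_subset _ _, ?_, ?_⟩
  · intro x hx y hy hxy hlt
    rw [Finset.mem_filter] at hy ⊢
    refine ⟨hx, hl (c x) x (by simp [hx]) y ?_ hlt⟩
    rw [hxy]; exact hy.2
  · intro b
    have : (X.filter fun x => x ∈ K (c x)).filter (c · = b) = K b := by
      ext x
      simp only [Finset.mem_filter]
      constructor
      · rintro ⟨⟨_, h⟩, rfl⟩; exact h
      · intro h
        have := hK b h
        rw [Finset.mem_filter] at this
        obtain ⟨h1, rfl⟩ := this
        exact ⟨⟨h1, h⟩, rfl⟩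
    rw [this, hc]
    have := Finset.card_le_card (Finset.filter_subset_filter (c · = b) hI)
    omega

open Classical in
theorem card_low_le {X : Finset α} {c : α → β} {d : α → ℕ}
    (hd : ∀ x ∈ X, ∀ y ∈ X, c x = c y → d x = d y → x = y) (R R' : ℕ → Prop)
    (hR : ∀ a b, a + b = X.card → R a → R' b) :
    (X.powerset.filter fun I => Low X c d I ∧ R I.card).card ≤
      (X.powerset.filter fun I => Low X c d I ∧ R' I.card).card := by
  have key : ∀ I : Finset α, ∃ J : Finset α, I ⊆ X → J ⊆ X ∧ Low X c d J ∧
      ∀ b, (I.filter (c · = b)).card + (J.filter (c · = b)).card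
        = (X.filter (c · = b)).card := by
    intro I
    by_cases hI : I ⊆ X
    · obtain ⟨J, h1, h2, h3⟩ := exists_compl_low hd hI
      exact ⟨J, fun _ => ⟨h1, h2, h3⟩⟩
    · exact ⟨∅, fun h => absurd h hI⟩
  choose φ hφ using key
  apply Finset.card_le_card_of_injOn φ
  · intro I hI
    simp only [Finset.coe_filter, Finset.mem_powerset, Set.mem_ofPred_eq] at hI ⊢
    obtain ⟨h1, h2, h3⟩ := hφ I hI.1
    refine ⟨h1, h2, hR I.card _ ?_ hI.2.2⟩
    have hm : ∀ Z : Finset α, Z ⊆ X → Z.card = ∑ b ∈ X.image c, (Z.filter (c · = b)).card :=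
      fun Z hZ => Finset.card_eq_sum_card_fiberwise
        (fun x hx => Finset.mem_coe.2 (Finset.mem_image_of_mem c (hZ hx)))
    rw [hm I hI.1, hm _ h1, hm X subset_rfl, ← Finset.sum_add_distrib]
    exact Finset.sum_congr rfl fun b _ => h3 b
  · intro I hI J hJ h
    simp only [Finset.coe_filter, Finset.mem_powerset, Set.mem_ofPred_eq] at hI hJ
    obtain ⟨_, _, h3⟩ := hφ I hI.1
    obtain ⟨_, _, h4⟩ := hφ J hJ.1
    have he : ∀ b, (I.filter (c · = b)).card = (J.filter (c · = b)).card := by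
      intro b
      have a1 := h3 b
      have a2 := h4 b
      rw [h] at a1
      omega
    exact Finset.Subset.antisymm (low_subset hd hI.1 hJ.1 hI.2.1 hJ.2.1 he)
      (low_subset hd hJ.1 hI.1 hJ.2.1 hI.2.1 fun b => (he b).symm)

end chains

open Classical in
/-- the good pairs of given sizes in a given class -/
noncomputable def fib (n : ℕ) [NeZero n] (C G : Finset (ZMod n)) (p q : ℕ) :
    Finset (Finset (ZMod n) × Finset (ZMod n)) :=
  Finset.univ.filter fun s => (s.1.card = p ∧ s.2.card = q) ∧ Good n s.1 s.2 ∧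
    (s.1 ∪ s.2 = C ∧ GG n s.1 s.2 = G)

theorem low_of_good {n : ℕ} [NeZero n] {P Q : Finset (ZMod n)}
    (hG : (GG n P Q).Nonempty) (N : ℕ) :
    ∀ y ∈ P \ GG n P Q, dst n (GG n P Q) y = N → ∀ x ∈ (P ∪ Q) \ GG n P Q,
      pv n (GG n P Q) x = pv n (GG n P Q) y → dst n (GG n P Q) x < dst n (GG n P Q) y →
        x ∈ P \ GG n P Q := by
  induction N using Nat.strong_induction_on with
  | _ N ih =>
    intro y hy hN x hx hxy hlt
    have hGP : GG n P Q ⊆ P := Finset.filter_subset _ _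
    have hGC : GG n P Q ⊆ P ∪ Q := hGP.trans Finset.subset_union_left
    have hyP := (Finset.mem_sdiff.1 hy).1
    have hxC := (Finset.mem_sdiff.1 hx).1
    have hCn : (P ∪ Q).Nonempty := hG.mono hGC
    obtain ⟨s1, s2⟩ := dst_spec hCn y
    have hpQ : pv n (P ∪ Q) y ∉ Q := by
      intro h
      exact (Finset.mem_sdiff.1 hy).2 (by simp [GG, hyP, h])
    have hpP : pv n (P ∪ Q) y ∈ P := by
      rw [Finset.mem_union] at s2
      exact s2.resolve_right hpQ
    have a1 := pv_add (GG n P Q) x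
    have a2 := pv_add (GG n P Q) y
    have hxe : y - ((dst n (GG n P Q) y - dst n (GG n P Q) x : ℕ) : ZMod n) = x := by
      rw [Nat.cast_sub hlt.le]
      linear_combination a1 - a2 - hxy
    have hle : dst n (P ∪ Q) y ≤ dst n (GG n P Q) y - dst n (GG n P Q) x :=
      dst_le (by omega) (by rw [hxe]; exact hxC)
    have hd1 := (dst_spec hG x).1
    have hpG : pv n (P ∪ Q) y ∉ GG n P Q := by
      intro h
      have := dst_le (S := GG n P Q) s1 h
      omega
    obtain ⟨b1, b2⟩ := dst_step hG hGC y hpG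
    have hmem : pv n (P ∪ Q) y ∈ P \ GG n P Q := Finset.mem_sdiff.2 ⟨hpP, hpG⟩
    rcases lt_or_ge (dst n (GG n P Q) x) (dst n (GG n P Q) (pv n (P ∪ Q) y)) with h | h
    · exact ih _ (by omega) _ hmem rfl x hx (hxy.trans b2) h
    · have : dst n (GG n P Q) x = dst n (GG n P Q) (pv n (P ∪ Q) y) := by omega
      have : x = pv n (P ∪ Q) y := by
        rw [← a1, ← pv_add (GG n P Q) (pv n (P ∪ Q) y), hxy, b2, this]
      rw [this]; exact hmem

theorem Q_of_good {n : ℕ} [NeZero n] {P Q : Finset (ZMod n)} (hg : Good n P Q) :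
    Q = ((P ∪ Q) \ (P \ GG n P Q)).image (pv n (P ∪ Q)) := by
  ext q
  rw [Finset.mem_image]
  constructor
  · intro hq
    obtain ⟨y, hy, rfl⟩ := pv_surj (S := P ∪ Q) (x := q) (by simp [hq])
    refine ⟨y, ?_, rfl⟩
    rw [Finset.mem_sdiff]
    refine ⟨hy, fun h => ?_⟩
    rw [Finset.mem_sdiff] at h
    exact h.2 (by simp [GG, h.1, hq])
  · rintro ⟨e, he, rfl⟩
    rw [Finset.mem_sdiff] at he
    by_cases heP : e ∈ P
    · by_contra hcon
      exact he.2 (by simp [GG, heP, hcon])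
    · exact (hg e he.1).resolve_left heP

theorem card_image_pv {n : ℕ} [NeZero n] {C I : Finset (ZMod n)} (hI : I ⊆ C) :
    ((C \ I).image (pv n C)).card + I.card = C.card := by
  rw [Finset.card_image_of_injOn, Finset.card_sdiff_of_subset hI]
  · have := Finset.card_le_card hI; omega
  · intro x hx y hy h
    exact pv_inj (Finset.mem_sdiff.1 hx).1 (Finset.mem_sdiff.1 hy).1 h

open Classical in
theorem card_fib {n : ℕ} [NeZero n] (C G : Finset (ZMod n)) (hG : G.Nonempty) (hGC : G ⊆ C)
    (p q : ℕ) :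
    (fib n C G p q).card = ((C \ G).powerset.filter fun I =>
      Low (C \ G) (pv n G) (dst n G) I ∧ (I.card + G.card = p ∧ q + I.card = C.card)).card := by
  apply Finset.card_nbij' (fun s => s.1 \ G) (fun I => (I ∪ G, (C \ I).image (pv n C)))
  · rintro ⟨P, Q⟩ hs
    simp only [fib, Finset.coe_filter, Finset.mem_univ, true_and, Set.mem_ofPred_eq,
      Finset.mem_powerset] at hs ⊢
    obtain ⟨⟨rfl, rfl⟩, hg, rfl, rfl⟩ := hs
    have hGP : GG n P Q ⊆ P := Finset.filter_subset _ _
    refine ⟨Finset.sdiff_subset_sdiff Finset.subset_union_left subset_rfl, ?_, ?_, ?_⟩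
    · intro x hx y hy hxy hlt
      exact low_of_good hG _ y hy rfl x hx hxy hlt
    · rw [Finset.card_sdiff_of_subset hGP]
      have := Finset.card_le_card hGP; omega
    · have h1 := card_image_pv (C := P ∪ Q) (I := P \ GG n P Q)
        (Finset.sdiff_subset.trans Finset.subset_union_left)
      rwa [← Q_of_good hg] at h1
  · intro I hI
    simp only [fib, Finset.coe_filter, Finset.mem_univ, true_and, Set.mem_ofPred_eq,
      Finset.mem_powerset] at hI ⊢
    obtain ⟨hIX, hl, h1, h2⟩ := hI
    have hIC : I ⊆ C := hIX.trans Finset.sdiff_subset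
    have hIG : ∀ x ∈ I, x ∉ G := fun x hx => (Finset.mem_sdiff.1 (hIX hx)).2
    have hCn : C.Nonempty := hG.mono hGC
    have hmemQ : ∀ e ∈ C, (pv n C e ∈ (C \ I).image (pv n C) ↔ e ∉ I) := by
      intro e he
      rw [Finset.mem_image]
      constructor
      · rintro ⟨f, hf, hfe⟩
        rw [Finset.mem_sdiff] at hf
        rw [← pv_inj hf.1 he hfe]; exact hf.2
      · intro h; exact ⟨e, by simp [he, h], rfl⟩
    have hU : (I ∪ G) ∪ (C \ I).image (pv n C) = C := by
      apply Finset.Subset.antisymm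
      · refine Finset.union_subset (Finset.union_subset hIC hGC) ?_
        intro x hx
        rw [Finset.mem_image] at hx
        obtain ⟨e, _, rfl⟩ := hx
        exact (dst_spec hCn e).2
      · intro e he
        by_cases heI : e ∈ I
        · simp [heI]
        by_cases heG : e ∈ G
        · simp [heG]
        obtain ⟨f, hf, rfl⟩ := pv_surj (S := C) he
        rw [Finset.mem_union]
        right
        rw [hmemQ f hf]
        intro hfI
        obtain ⟨b1, b2⟩ := dst_step hG hGC f heG
        have := (dst_spec hCn f).1
        exact heI (hl _ (by simp [he, heG]) f hfI b2.symm (by omega))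
    refine ⟨⟨?_, ?_⟩, ?_, hU, ?_⟩
    · rw [Finset.card_union_of_disjoint, h1]
      exact Finset.disjoint_left.2 hIG
    · have := card_image_pv hIC; omega
    · intro e he
      rw [hU] at he ⊢
      rw [hmemQ e he, Finset.mem_union]
      tauto
    · ext e
      simp only [GG, Finset.mem_filter]
      rw [hU]
      constructor
      · rintro ⟨h, h'⟩
        rw [Finset.mem_union] at h
        rcases h with h | h
        · exact absurd h ((hmemQ e (hIC h)).1 h')
        · exact h
      · intro h
        exact ⟨Finset.mem_union_right _ h, (hmemQ e (hGC h)).2 fun h' => hIG e h' h⟩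
  · rintro ⟨P, Q⟩ hs
    simp only [fib, Finset.coe_filter, Finset.mem_univ, true_and, Set.mem_ofPred_eq] at hs
    obtain ⟨⟨rfl, rfl⟩, hg, rfl, rfl⟩ := hs
    have hGP : GG n P Q ⊆ P := Finset.filter_subset _ _
    simp only [Prod.mk.injEq]
    exact ⟨Finset.sdiff_union_of_subset hGP, (Q_of_good hg).symm⟩
  · intro I hI
    simp only [Finset.coe_filter, Set.mem_ofPred_eq, Finset.mem_powerset] at hI
    have hIG : ∀ x ∈ I, x ∉ G := fun x hx => (Finset.mem_sdiff.1 (hI.1 hx)).2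
    ext x
    simp only [Finset.mem_sdiff, Finset.mem_union]
    have := hIG x
    tauto

theorem card_fib_le {n : ℕ} [NeZero n] (C G : Finset (ZMod n)) (p q : ℕ) (hp : 1 ≤ p)
    (hq : 1 ≤ q) : (fib n C G p q).card ≤ (fib n C G q p).card := by
  rcases Finset.eq_empty_or_nonempty (fib n C G p q) with h | ⟨⟨P, Q⟩, h⟩
  · rw [h]; simp
  simp only [fib, Finset.mem_filter, Finset.mem_univ, true_and] at h
  obtain ⟨⟨h1, h2⟩, hg, h3, h4⟩ := h
  have hG : G.Nonempty := by
    rw [← h4]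
    apply GG_nonempty <;> rw [← Finset.card_pos] <;> omega
  have hGC : G ⊆ C := by
    rw [← h4, ← h3]
    exact (Finset.filter_subset _ _).trans Finset.subset_union_left
  classical
  rw [card_fib C G hG hGC, card_fib C G hG hGC]
  have key := card_low_le (X := C \ G) (c := pv n G) (d := dst n G)
    (fun x hx y hy h5 h6 => by rw [← pv_add G x, ← pv_add G y, h5, h6])
    (fun a => a + G.card = p ∧ q + a = C.card) (fun a => a + G.card = q ∧ p + a = C.card)
    (fun a b hab => by
      rw [Finset.card_sdiff_of_subset hGC] at hab
      have := Finset.card_le_card hGC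
      omega)
  convert key

open Classical in
theorem sum_WW {n : ℕ} [NeZero n] (hn : 3 ≤ n) (p q : ℕ) (hp : 1 ≤ p) :
    ∑ P ∈ Finset.powersetCard p (Finset.univ : Finset (ZMod n)),
      ∑ Q ∈ Finset.powersetCard q (Finset.univ : Finset (ZMod n)), WW n P Q
    = ∑ κ : Finset (ZMod n) × Finset (ZMod n),
        (fib n κ.1 κ.2 p q).card • WW n κ.1 (κ.2.image (pv n κ.1)) := by
  rw [← Finset.sum_product']
  have h1 : Finset.powersetCard p (Finset.univ : Finset (ZMod n)) ×ˢ
      Finset.powersetCard q (Finset.univ : Finset (ZMod n))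
      = Finset.univ.filter fun s : Finset (ZMod n) × Finset (ZMod n) =>
        s.1.card = p ∧ s.2.card = q := by
    ext s; simp [Finset.mem_powersetCard]
  rw [h1]
  have h2 : ∑ s ∈ Finset.univ.filter (fun s : Finset (ZMod n) × Finset (ZMod n) =>
        s.1.card = p ∧ s.2.card = q), WW n s.1 s.2
      = ∑ s ∈ (Finset.univ.filter (fun s : Finset (ZMod n) × Finset (ZMod n) =>
        s.1.card = p ∧ s.2.card = q)).filter (fun s => Good n s.1 s.2), WW n s.1 s.2 := by
    symm
    apply Finset.sum_filter_of_ne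
    intro s _ hs
    by_contra hcon
    unfold Good at hcon
    push Not at hcon
    obtain ⟨e, he, h3, h4⟩ := hcon
    exact hs (WW_bad' hn _ _ e he h3 h4)
  rw [h2, ← Finset.sum_fiberwise _ (fun s => (s.1 ∪ s.2, GG n s.1 s.2))]
  apply Finset.sum_congr rfl
  rintro ⟨C, G⟩ _
  have h3 : ((Finset.univ.filter (fun s : Finset (ZMod n) × Finset (ZMod n) =>
        s.1.card = p ∧ s.2.card = q)).filter (fun s => Good n s.1 s.2)).filter
        (fun s => (s.1 ∪ s.2, GG n s.1 s.2) = (C, G)) = fib n C G p q := by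
    ext s
    simp [fib, and_assoc]
  rw [h3, ← Finset.sum_const]
  apply Finset.sum_congr rfl
  rintro ⟨P, Q⟩ hs
  simp only [fib, Finset.mem_filter, Finset.mem_univ, true_and] at hs
  obtain ⟨⟨h4, h5⟩, hg, h6, h7⟩ := hs
  exact WW_canon hn C G _ P Q (by rw [← Finset.card_pos]; omega) h6 hg h7 rfl

theorem image_cast (n : ℕ) [NeZero n] :
    (Finset.range n).image (Nat.cast : ℕ → ZMod n) = Finset.univ := by
  ext x
  simp only [Finset.mem_image, Finset.mem_range, Finset.mem_univ, iff_true]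
  exact ⟨x.val, ZMod.val_lt x, by simp⟩

theorem hU_compl {n : ℕ} [NeZero n] (k : ℕ) (hk : k ≤ n) :
    hU n k = ∑ P ∈ Finset.powersetCard (n - k) (Finset.univ : Finset (ZMod n)), uA n Pᶜ := by
  rw [hU, image_cast]
  apply Finset.sum_nbij' (fun A => Aᶜ) (fun A => Aᶜ)
  · intro A hA
    simp only [Finset.mem_powersetCard, Finset.subset_univ, true_and] at hA ⊢
    rw [Finset.card_compl, ZMod.card, hA]
  · intro A hA
    simp only [Finset.mem_powersetCard, Finset.subset_univ, true_and] at hA ⊢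
    rw [Finset.card_compl, ZMod.card, hA]; omega
  · intro A _; simp
  · intro A _; simp
  · intro A _; simp

theorem BB_eq {n : ℕ} [NeZero n] (Q : Finset (ZMod n)) :
    BB n Q = (Q.map (Equiv.addRight (1 : ZMod n)).toEmbedding)ᶜ := by
  ext x
  simp [BB, sub_eq_add_neg]

theorem hU_BB {n : ℕ} [NeZero n] (k : ℕ) (hk : k ≤ n) :
    hU n k = ∑ Q ∈ Finset.powersetCard (n - k) (Finset.univ : Finset (ZMod n)),
      uA n (BB n Q) := by
  rw [hU_compl k hk]
  symm
  apply Finset.sum_nbij' (fun A => A.map (Equiv.addRight (1 : ZMod n)).toEmbedding)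
    (fun A => A.map (Equiv.addRight (1 : ZMod n)).symm.toEmbedding)
  · intro A hA
    simpa [Finset.mem_powersetCard] using hA
  · intro A hA
    simpa [Finset.mem_powersetCard] using hA
  · intro A _; ext x; simp
  · intro A _; ext x; simp
  · intro A _; rw [BB_eq]

theorem hU_mul {n : ℕ} [NeZero n] (hn : 3 ≤ n) (k l : ℕ) (hk : k ≤ n - 1) (hl : l ≤ n - 1) :
    hU n k * hU n l = ∑ κ : Finset (ZMod n) × Finset (ZMod n),
        (fib n κ.1 κ.2 (n - k) (n - l)).card • WW n κ.1 (κ.2.image (pv n κ.1)) := by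
  classical
  rw [← sum_WW hn _ _ (by omega), hU_compl k (by omega), hU_BB l (by omega),
    Finset.sum_mul_sum]
  rfl

/-- In the affine nilCoxeter algebra `U_n`, the elements `h_0(u), …, h_{n-1}(u)`
pairwise commute. -/
theorem hU_commute (n : ℕ) (hn : 3 ≤ n) (k l : ℕ) (hk : k ≤ n - 1) (hl : l ≤ n - 1) :
    hU n k * hU n l = hU n l * hU n k := by
  have : NeZero n := ⟨by omega⟩
  rw [hU_mul hn k l hk hl, hU_mul hn l k hl hk]
  apply Finset.sum_congr rfl
  intro κ _
  rw [le_antisymm (card_fib_le κ.1 κ.2 (n - k) (n - l) (by omega) (by omega))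
    (card_fib_le κ.1 κ.2 (n - l) (n - k) (by omega) (by omega))]
end

section
/- In the affine nilCoxeter algebra U_n, the commuting elements h_1(u), h_2(u), …, h_{n−1}(u) are algebraically independent over ℂ: the unique ℂ-algebra homomorphism from the polynomial ring ℂ[X_1,…,X_{n−1}] to U_n sending X_k to h_k(u) for 1 ≤ k ≤ n−1 is injective. (Hence the subalgebra of U_n they generate is isomorphic to a polynomial ring in n−1 variables.) -/
open scoped BigOperators

/-- Evaluation of a polynomial in `n - 1` (commuting) variables at the commuting elements
`h_1(u), …, h_{n-1}(u)` of `U_n`: this is the unique `ℂ`-algebra homomorphism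
`ℂ[X_1, …, X_{n-1}] → U_n` sending `X_k` to `h_k(u)`. -/
noncomputable def evalH (n : ℕ) (P : MvPolynomial (Fin (n - 1)) ℂ) : NilCox n :=
  ∑ m ∈ P.support,
    MvPolynomial.coeff m P •
      ((List.finRange (n - 1)).map fun i => hU n (i.val + 1) ^ m i).prod

namespace NilCoxProof

open Equiv

/-- States: an arrangement of `n` species on a circle, with a counter for each species. -/
abbrev St (n : ℕ) := Equiv.Perm (ZMod n) × (ZMod n → ℕ)

/-- one move: the species at `i` passes the smaller species at `i+1`. -/
noncomputable def step (n : ℕ) (i : ZMod n) (x : St n) : Option (St n) :=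
  if (x.1 (i + 1)).val < (x.1 i).val then
    some (x.1 * swap i (i + 1), x.2 + Pi.single (x.1 (i + 1)) 1) else none

/-- the linear operator of a partial map -/
noncomputable def op {n : ℕ} (s : St n → Option (St n)) : Module.End ℂ (St n →₀ ℂ) :=
  Finsupp.lift (St n →₀ ℂ) ℂ (St n) (fun x => (s x).elim 0 (fun y => Finsupp.single y 1))

lemma op_single {n : ℕ} (s : St n → Option (St n)) (x : St n) :
    op s (Finsupp.single x 1) = (s x).elim 0 (fun y => Finsupp.single y 1) := by
  simp [op]

lemma op_comp {n : ℕ} (s t : St n → Option (St n)) :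
    op s * op t = op (fun x => (t x).bind s) := by
  refine Finsupp.lhom_ext' fun x => LinearMap.ext_ring ?_
  simp only [LinearMap.comp_apply, Finsupp.lsingle_apply, Module.End.mul_apply, op_single]
  cases h : t x <;> simp [op_single]

lemma op_some {n : ℕ} : op (fun x : St n => some x) = 1 := by
  refine Finsupp.lhom_ext' fun x => LinearMap.ext_ring ?_
  simp [op_single]

lemma op_none {n : ℕ} : op (fun _ : St n => none) = 0 := by
  refine Finsupp.lhom_ext' fun x => LinearMap.ext_ring ?_
  simp [op_single]

lemma step_sq (n : ℕ) (i : ZMod n) (x : St n) : (step n i x).bind (step n i) = none := by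
  unfold step
  split_ifs with h
  · simp [Perm.mul_apply]; omega
  · rfl

lemma step_comm (n : ℕ) (hn : 3 ≤ n) (i j : ZMod n) (h1 : i - j ≠ 1) (h2 : j - i ≠ 1) (x : St n) :
    (step n j x).bind (step n i) = (step n i x).bind (step n j) := by
  have : Fact (1 < n) := ⟨by omega⟩
  by_cases hij : i = j
  · rw [hij]
  have a1 : i ≠ j + 1 := fun h => h1 (by rw [h]; ring)
  have a2 : j ≠ i + 1 := fun h => h2 (by rw [h]; ring)
  have a3 : i + 1 ≠ j + 1 := fun h => hij (add_right_cancel h)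
  have d : Perm.Disjoint (swap i (i+1)) (swap j (j+1)) := by
    apply Equiv.Perm.disjoint_swap_swap
    simp [hij, a1, a2.symm, a3, Ne.symm hij, a1.symm, a2, a3.symm]
  have c : swap i (i+1) * swap j (j+1) = swap j (j+1) * swap i (i+1) := d.commute
  unfold step
  by_cases p : (x.1 (i + 1)).val < (x.1 i).val <;> by_cases q : (x.1 (j + 1)).val < (x.1 j).val <;>
    simp [p, q, Perm.mul_apply, swap_apply_of_ne_of_ne, hij, a1, a2, a3, Ne.symm hij, a1.symm, a2.symm, a3.symm]
  · rw [mul_assoc, mul_assoc, c]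
    exact ⟨rfl, by abel⟩

lemma step_braid (n : ℕ) (hn : 3 ≤ n) (i : ZMod n) (x : St n) :
    ((step n i x).bind (step n (i+1))).bind (step n i) =
      ((step n (i+1) x).bind (step n i)).bind (step n (i+1)) := by
  have : Fact (1 < n) := ⟨by omega⟩
  have a1 : i ≠ i + 1 := by simp
  have a2 : i + 1 ≠ i + 1 + 1 := by simp
  have a3 : i ≠ i + 1 + 1 := by
    intro h
    have h' : ((2 : ℕ) : ZMod n) = 0 := by
      have : i + 0 = i + 2 := by rw [add_zero]; nth_rw 1 [h]; ring
      simpa using (add_left_cancel this).symm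
    rw [ZMod.natCast_eq_zero_iff] at h'
    exact absurd (Nat.le_of_dvd (by norm_num) h') (by omega)
  have c : swap i (i+1) * (swap (i+1) (i+1+1) * swap i (i+1)) =
      swap (i+1) (i+1+1) * (swap i (i+1) * swap (i+1) (i+1+1)) := by
    have e1 := swap_mul_swap_mul_swap (x := i+1+1) (y := i+1) (z := i) a2.symm a3.symm
    have e2 := swap_mul_swap_mul_swap (x := i) (y := i+1) (z := i+1+1) a1 a3
    rw [swap_comm (i+1) i, swap_comm (i+1+1) (i+1)] at e1
    rw [← mul_assoc, ← mul_assoc, e1, e2, swap_comm]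
  unfold step
  by_cases p : (x.1 (i + 1)).val < (x.1 i).val <;>
  by_cases q : (x.1 (i + 1 + 1)).val < (x.1 (i+1)).val
  · have r : (x.1 (i + 1 + 1)).val < (x.1 i).val := q.trans p
    simp [p, q, r, Perm.mul_apply, swap_apply_of_ne_of_ne, a1, a2, a3, a1.symm, a2.symm, a3.symm, mul_assoc, c]
    abel
  all_goals
    by_cases r : (x.1 (i + 1 + 1)).val < (x.1 i).val <;>
    simp [p, q, r, Perm.mul_apply, swap_apply_of_ne_of_ne, a1, a2, a3, a1.symm, a2.symm, a3.symm]
  all_goals omega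

/-- the representation of the affine nilCoxeter algebra -/
noncomputable def rep (n : ℕ) (hn : 3 ≤ n) : NilCox n →ₐ[ℂ] Module.End ℂ (St n →₀ ℂ) :=
  RingQuot.liftAlgHom ℂ ⟨FreeAlgebra.lift ℂ (fun i => op (step n i)), by
    intro a b h
    cases h with
    | sq i =>
      simp only [map_mul, FreeAlgebra.lift_ι_apply, op_comp, step_sq, op_none, map_zero]
    | braid i =>
      simp only [map_mul, FreeAlgebra.lift_ι_apply, op_comp, mul_assoc]
      congr 1
      funext x
      simpa using step_braid n hn i x
    | comm i j h1 h2 =>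
      simp only [map_mul, FreeAlgebra.lift_ι_apply, op_comp]
      congr 1
      funext x
      exact step_comm n hn i j h1 h2 x⟩

lemma rep_uG (n : ℕ) (hn : 3 ≤ n) (i : ZMod n) : rep n hn (uG n i) = op (step n i) := by
  simp [rep, uG]

/-- apply a word, last letter first -/
noncomputable def run (n : ℕ) : List (ZMod n) → St n → Option (St n)
  | [], x => some x
  | a :: L, x => (run n L x).bind (step n a)

lemma rep_list (n : ℕ) (hn : 3 ≤ n) (L : List (ZMod n)) :
    rep n hn (L.map (uG n)).prod = op (run n L) := by
  induction L with
  | nil =>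
    rw [List.map_nil, List.prod_nil, map_one]
    exact op_some.symm
  | cons a L ih =>
    rw [List.map_cons, List.prod_cons, map_mul, ih, rep_uG, op_comp]
    rfl

/-- statistic: number of times that a species `< k` has been passed -/
def Q (n : ℕ) [NeZero n] (k : ℕ) (x : St n) : ℕ := ∑ s : ZMod n, if s.val < k then x.2 s else 0

/-- the admissible words -/
def Adm (n : ℕ) (L : List (ZMod n)) : Prop := L.Pairwise fun a b => b ≠ a ∧ b ≠ a + 1

lemma Q_add (n : ℕ) [NeZero n] (k : ℕ) (σ τ : Perm (ZMod n)) (N : ZMod n → ℕ) (s : ZMod n) :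
    Q n k (σ, N + Pi.single s 1) = Q n k (τ, N) + if s.val < k then 1 else 0 := by
  unfold Q
  have : ∀ t : ZMod n, (if t.val < k then (N + Pi.single s 1 : ZMod n → ℕ) t else 0) =
      (if t.val < k then N t else 0) + if t = s then (if s.val < k then 1 else 0) else 0 := by
    intro t
    by_cases h : t = s
    · subst h; simp; split_ifs <;> simp
    · simp [h]
  simp only [this, Finset.sum_add_distrib]
  simp

lemma run_Q (n : ℕ) [NeZero n] (k : ℕ) (L : List (ZMod n)) (hL : Adm n L) (x y : St n)
    (h : run n L x = some y) :
    Q n k y = Q n k x + L.countP (fun p => (y.1 p).val < k) := by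
  induction L generalizing y with
  | nil => simp [run] at h; simp [h]
  | cons a L ih =>
    rw [run, Option.bind_eq_some_iff] at h
    obtain ⟨z, hz, hy⟩ := h
    obtain ⟨h1, h2⟩ := List.pairwise_cons.1 hL
    have := ih h2 z hz
    unfold step at hy
    split_ifs at hy with hlt
    obtain rfl := Option.some.inj hy
    rw [Q_add n k _ z.1, List.countP_cons, this, add_assoc]
    have : L.countP (fun p => ((z.1 * swap a (a+1)) p).val < k) =
        L.countP (fun p => (z.1 p).val < k) := by
      apply List.countP_congr
      intro p hp
      simp [Perm.mul_apply, swap_apply_of_ne_of_ne (h1 p hp).1 (h1 p hp).2]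
    simp only [this]
    simp [Perm.mul_apply]

lemma run_exists (n : ℕ) (hn : 3 ≤ n) (j : ℕ) (x : St n) (L : List (ZMod n)) (hL : Adm n L)
    (hD : ∀ p ∈ L, (x.1 (p + 1)).val < j)
    (hC : ∀ p ∈ L, (x.1 p).val < j → p - 1 ∈ L) :
    ∃ y, run n L x = some y ∧ (∀ q, q ∉ L → q - 1 ∉ L → y.1 q = x.1 q) ∧
      (∀ p ∈ L, p + 1 ∉ L → j ≤ (y.1 (p+1)).val) ∧ (∀ p ∈ L, (y.1 p).val < j) := by
  have : Fact (1 < n) := ⟨by omega⟩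
  induction L with
  | nil => exact ⟨x, rfl, by simp, by simp, by simp⟩
  | cons a L ih =>
    obtain ⟨h1, h2⟩ := List.pairwise_cons.1 hL
    have ha : a ∉ L := fun h => (h1 a h).1 rfl
    have ha1 : a + 1 ∉ L := fun h => (h1 _ h).2 rfl
    obtain ⟨z, hz, i1, i2, i3⟩ := ih h2 (fun p hp => hD p (List.mem_cons_of_mem _ hp)) (by
      intro p hp hl
      rcases List.mem_cons.1 (hC p (List.mem_cons_of_mem _ hp) hl) with h | h
      · exact absurd (by rw [← h]; ring) (h1 p hp).2
      · exact h)
    have low : (z.1 (a+1)).val < j := by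
      rw [i1 _ ha1 (by simpa using ha)]
      exact hD a (by simp)
    have high : j ≤ (z.1 a).val := by
      by_cases hm : a - 1 ∈ L
      · have := i2 _ hm (by simpa using ha)
        simpa using this
      · rw [i1 _ ha hm]
        by_contra hlt
        rcases List.mem_cons.1 (hC a (by simp) (by omega)) with h | h
        · simp at h
        · exact hm h
    refine ⟨(z.1 * swap a (a + 1), z.2 + Pi.single (z.1 (a + 1)) 1), ?_, ?_, ?_, ?_⟩
    · rw [run, hz, Option.bind_some, step, if_pos (by omega)]
    · intro q hq hq'
      simp only [List.mem_cons, not_or] at hq hq'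
      have : q ≠ a + 1 := fun h => hq'.1 (by rw [h]; ring)
      simp [Perm.mul_apply, swap_apply_of_ne_of_ne hq.1 this, i1 q hq.2 hq'.2]
    · intro p hp hp1
      simp only [List.mem_cons, not_or] at hp1
      rcases List.mem_cons.1 hp with rfl | hp
      · simpa [Perm.mul_apply] using high
      · have : p + 1 ≠ a + 1 := fun h => (h1 p hp).1 (add_right_cancel h)
        simpa [Perm.mul_apply, swap_apply_of_ne_of_ne hp1.1 this] using i2 p hp hp1.2
    · intro p hp
      rcases List.mem_cons.1 hp with rfl | hp
      · simpa [Perm.mul_apply] using low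
      · simpa [Perm.mul_apply, swap_apply_of_ne_of_ne (h1 p hp).1 (h1 p hp).2] using i3 p hp

/-- the word of `A` -/
noncomputable def word (n : ℕ) (A : Finset (ZMod n)) : List (ZMod n) :=
  A.toList.insertionSort fun x y => (y - miss n A).val ≤ (x - miss n A).val

lemma word_perm (n : ℕ) (A : Finset (ZMod n)) : (word n A).Perm A.toList :=
  List.perm_insertionSort _ _

lemma mem_word (n : ℕ) (A : Finset (ZMod n)) (a : ZMod n) : a ∈ word n A ↔ a ∈ A := by
  rw [(word_perm n A).mem_iff, Finset.mem_toList]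

lemma miss_notMem (n : ℕ) [NeZero n] (A : Finset (ZMod n)) (hA : A.card < n) : miss n A ∉ A := by
  unfold miss
  cases h : (List.range n).find? fun k : ℕ => decide (((k : ℕ) : ZMod n) ∉ A) with
  | some k =>
    have := List.find?_some h
    simpa using this
  | none =>
    exfalso
    rw [List.find?_eq_none] at h
    have : A = Finset.univ := by
      ext a
      have := h a.val (by simpa using ZMod.val_lt a)
      simpa using this
    rw [this, Finset.card_univ, ZMod.card] at hA
    exact lt_irrefl _ hA

lemma word_adm (n : ℕ) (hn : 3 ≤ n) (A : Finset (ZMod n)) (hA : A.card < n) : Adm n (word n A) := by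
  have : NeZero n := ⟨by omega⟩
  have : Fact (1 < n) := ⟨by omega⟩
  have hm := miss_notMem n A hA
  have nd : (word n A).Nodup := (word_perm n A).nodup_iff.2 A.nodup_toList
  have srt : (word n A).Pairwise fun x y => (y - miss n A).val ≤ (x - miss n A).val := by
    haveI : Std.Total (fun x y : ZMod n => (y - miss n A).val ≤ (x - miss n A).val) :=
      ⟨fun a b => le_total _ _⟩
    haveI : IsTrans (ZMod n) (fun x y : ZMod n => (y - miss n A).val ≤ (x - miss n A).val) :=
      ⟨fun a b c h h' => h'.trans h⟩
    exact List.pairwise_insertionSort _ _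
  refine (srt.and nd).imp_of_mem ?_
  rintro a b - hb ⟨h, hne⟩
  refine ⟨hne.symm, ?_⟩
  rintro rfl
  rw [mem_word] at hb
  have h0 : a + 1 - miss n A ≠ 0 := fun h0 => hm (by rwa [← sub_eq_zero.1 h0])
  have e : a + 1 - miss n A = (a - miss n A) + 1 := by ring
  rw [e] at h h0
  generalize a - miss n A = c at h h0
  have := ZMod.val_add c 1
  rw [ZMod.val_one] at this
  have hc := ZMod.val_lt c
  rcases Nat.lt_or_ge (c.val + 1) n with hh | hh
  · rw [Nat.mod_eq_of_lt hh] at this; omega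
  · have : c.val + 1 = n := by omega
    apply h0
    rw [← ZMod.natCast_zmod_val c]
    have : ((c.val + 1 : ℕ) : ZMod n) = 0 := by rw [this]; simp
    exact_mod_cast this

lemma rep_uA (n : ℕ) (hn : 3 ≤ n) (A : Finset (ZMod n)) :
    rep n hn (uA n A) = op (run n (word n A)) := rep_list n hn _

lemma card_val_lt (n : ℕ) [NeZero n] (k : ℕ) (hk : k ≤ n) :
    (Finset.univ.filter fun s : ZMod n => s.val < k).card = k := by
  rw [← Finset.card_range k]
  apply Finset.card_bij (fun s _ => s.val)
  · simp
  · intro a _ b _ h; exact ZMod.val_injective n h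
  · intro b hb
    rw [Finset.mem_range] at hb
    have : (b : ZMod n).val = b := ZMod.val_natCast_of_lt (by omega)
    exact ⟨b, by simp [this, hb], this⟩

lemma word_count (n : ℕ) (A : Finset (ZMod n)) (p : ZMod n → Prop) [DecidablePred p] :
    (word n A).countP (fun a => p a) = (A.filter p).card := by
  rw [(word_perm n A).countP_eq, List.countP_eq_length_filter, ← Finset.length_toList]
  apply List.Perm.length_eq
  rw [List.perm_ext_iff_of_nodup (A.nodup_toList.filter _) (Finset.nodup_toList _)]
  simp

lemma word_Q_le (n : ℕ) (hn : 3 ≤ n) [NeZero n] (A : Finset (ZMod n)) (hA : A.card < n) (x y : St n)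
    (h : run n (word n A) x = some y) (k : ℕ) : Q n k y ≤ Q n k x + min A.card k := by
  rw [run_Q n k _ (word_adm n hn A hA) x y h, word_count n A (fun p => (y.1 p).val < k)]
  gcongr
  refine le_min (Finset.card_filter_le _ _) ?_
  calc _ = ((A.filter (fun p => (y.1 p).val < k)).image fun p => (y.1 p).val).card := by
        rw [Finset.card_image_of_injective]
        exact (ZMod.val_injective n).comp y.1.injective
    _ ≤ (Finset.range k).card := by
        apply Finset.card_le_card
        intro b hb
        simp only [Finset.mem_image, Finset.mem_filter] at hb
        obtain ⟨a, ha, rfl⟩ := hb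
        simpa using ha.2
    _ = k := by simp

lemma word_exists (n : ℕ) (hn : 3 ≤ n) [NeZero n] (j : ℕ) (hj : j < n) (x : St n) :
    ∃ A : Finset (ZMod n), A.card = j ∧ ∃ y, run n (word n A) x = some y ∧
      ∀ k, Q n k y = Q n k x + min j k := by
  set A : Finset (ZMod n) := Finset.univ.filter fun p => (x.1 (p + 1)).val < j with hAdef
  have cA : A.card = j := by
    rw [← card_val_lt n j hj.le]
    apply Finset.card_bij (fun p _ => x.1 (p + 1))
    · simp [hAdef]
    · intro a _ b _ h; exact add_right_cancel (x.1.injective h)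
    · intro b hb; exact ⟨x.1.symm b - 1, by simpa [hAdef] using hb, by simp⟩
  have adm := word_adm n hn A (by omega)
  obtain ⟨y, hy, -, -, hlow⟩ := run_exists n hn j x (word n A) adm
    (fun p hp => by rw [mem_word] at hp; simpa [hAdef] using hp)
    (fun p hp h => by rw [mem_word]; simpa [hAdef] using h)
  refine ⟨A, cA, y, hy, fun k => ?_⟩
  rw [run_Q n k _ adm x y hy, word_count n A (fun p => (y.1 p).val < k)]
  congr 1
  have hA2 : A = Finset.univ.filter fun p => (y.1 p).val < j := by
    apply Finset.eq_of_subset_of_card_le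
    · intro p hp
      simpa using hlow p ((mem_word _ _ _).2 hp)
    · refine (?_ : _ ≤ (Finset.univ.filter fun s : ZMod n => s.val < j).card).trans
        (by rw [cA, card_val_lt n j hj.le])
      refine Finset.card_le_card_of_injOn (fun p => y.1 p) ?_ y.1.injective.injOn
      intro p hp
      simpa using hp
  rw [hA2, Finset.filter_filter]
  have hm := card_val_lt n (min j k) (by omega)
  rw [← hm]
  apply Finset.card_bij (fun p _ => y.1 p)
  · simp
  · intro a _ b _ h; exact y.1.injective h
  · intro b hb; exact ⟨y.1.symm b, by simpa using hb, by simp⟩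

open scoped ComplexOrder

/-- states with bounded statistics -/
def SS (n : ℕ) [NeZero n] (f : ℕ → ℕ) : Set (St n) := {x | ∀ k, Q n k x ≤ f k}

lemma op_supp (n : ℕ) (s : St n → Option (St n)) (S T : Set (St n))
    (h : ∀ x ∈ S, ∀ y, s x = some y → y ∈ T) (v : St n →₀ ℂ) (hv : v ∈ Finsupp.supported ℂ ℂ S) :
    op s v ∈ Finsupp.supported ℂ ℂ T := by
  have : Finsupp.supported ℂ ℂ S ≤ (Finsupp.supported ℂ ℂ T).comap (op s) := by
    rw [Finsupp.supported_eq_span_single, Submodule.span_le]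
    rintro _ ⟨x, hx, rfl⟩
    simp only [Submodule.comap_coe, Set.mem_preimage, op_single, SetLike.mem_coe]
    cases hs : s x with
    | none => simp
    | some y => exact Finsupp.single_mem_supported ℂ _ (h x hx y hs)
  exact this hv

lemma op_apply (n : ℕ) (s : St n → Option (St n)) (v : St n →₀ ℂ) (y : St n) [DecidableEq (St n)] :
    op s v y = ∑ x ∈ v.support, if s x = some y then v x else 0 := by
  simp only [op, Finsupp.lift_apply, Finsupp.sum, Finsupp.finsetSum_apply, Finsupp.smul_apply]
  refine Finset.sum_congr rfl fun x _ => ?_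
  cases hs : s x with
  | none => simp
  | some z => simp [Finsupp.single_apply]

lemma op_nonneg (n : ℕ) (s : St n → Option (St n)) (v : St n →₀ ℂ) (hv : ∀ x, 0 ≤ v x) (y : St n) :
    0 ≤ op s v y := by
  classical
  rw [op_apply]
  refine Finset.sum_nonneg fun x _ => ?_
  split_ifs
  · exact hv x
  · exact le_rfl

lemma op_ge (n : ℕ) (s : St n → Option (St n)) (v : St n →₀ ℂ) (hv : ∀ x, 0 ≤ v x) (x y : St n)
    (h : s x = some y) : v x ≤ op s v y := by
  classical
  by_cases hx : x ∈ v.support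
  · rw [op_apply]
    have := Finset.single_le_sum (f := fun x => if s x = some y then v x else 0)
      (s := v.support) (fun x _ => by split_ifs; exacts [hv x, le_rfl]) hx
    simpa [h] using this
  · rw [Finsupp.notMem_support_iff.1 hx]
    exact op_nonneg n s v hv y

/-- elements acting with leading weight `w` -/
structure Good (n : ℕ) (hn : 3 ≤ n) [NeZero n] (g : NilCox n) (w : ℕ → ℕ) : Prop where
  bd : ∀ f v, v ∈ Finsupp.supported ℂ ℂ (SS n f) →
    rep n hn g v ∈ Finsupp.supported ℂ ℂ (SS n (f + w))
  nn : ∀ v : St n →₀ ℂ, (∀ x, 0 ≤ v x) → ∀ x, 0 ≤ rep n hn g v x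
  ex : ∀ x, ∃ y, (∀ k, Q n k y = Q n k x + w k) ∧
    ∀ v : St n →₀ ℂ, (∀ x, 0 ≤ v x) → v x ≤ rep n hn g v y

lemma Good.one (n : ℕ) (hn : 3 ≤ n) [NeZero n] : Good n hn 1 0 where
  bd f v hv := by simpa using hv
  nn v hv x := by simpa using hv x
  ex x := ⟨x, by simp, by simp⟩

lemma Good.mul {n : ℕ} {hn : 3 ≤ n} [NeZero n] {g g' : NilCox n} {w w' : ℕ → ℕ}
    (h : Good n hn g w) (h' : Good n hn g' w') : Good n hn (g * g') (w + w') where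
  bd f v hv := by
    have := h.bd _ _ (h'.bd f v hv)
    rw [map_mul, Module.End.mul_apply, add_comm w w', ← add_assoc]
    exact this
  nn v hv x := by
    rw [map_mul, Module.End.mul_apply]
    exact h.nn _ (h'.nn v hv) x
  ex x := by
    obtain ⟨y, hy, hy'⟩ := h'.ex x
    obtain ⟨z, hz, hz'⟩ := h.ex y
    refine ⟨z, fun k => ?_, fun v hv => ?_⟩
    · rw [hz, hy, Pi.add_apply]; ring
    · rw [map_mul, Module.End.mul_apply]
      exact (hy' v hv).trans (hz' _ (h'.nn v hv))

lemma Good.pow {n : ℕ} {hn : 3 ≤ n} [NeZero n] {g : NilCox n} {w : ℕ → ℕ}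
    (h : Good n hn g w) (m : ℕ) : Good n hn (g ^ m) (m • w) := by
  induction m with
  | zero => simpa using Good.one n hn
  | succ m ih => rw [pow_succ, succ_nsmul]; exact ih.mul h

lemma Good.list {n : ℕ} {hn : 3 ≤ n} [NeZero n] {ι : Type} (L : List ι) (g : ι → NilCox n)
    (w : ι → ℕ → ℕ) (h : ∀ i, Good n hn (g i) (w i)) :
    Good n hn (L.map g).prod (L.map w).sum := by
  induction L with
  | nil => simpa using Good.one n hn
  | cons a L ih => simpa using (h a).mul ih

lemma rep_hU (n : ℕ) (hn : 3 ≤ n) [NeZero n] (j : ℕ) :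
    rep n hn (hU n j) = ∑ A ∈ Finset.powersetCard j (Finset.univ : Finset (ZMod n)),
      op (run n (word n A)) := by
  have : (Finset.range n).image (Nat.cast : ℕ → ZMod n) = Finset.univ := by
    ext a
    simp only [Finset.mem_image, Finset.mem_range, Finset.mem_univ, iff_true]
    exact ⟨a.val, ZMod.val_lt a, by simp⟩
  rw [hU, this, map_sum]
  simp only [rep_uA]

lemma Good.hU (n : ℕ) (hn : 3 ≤ n) [NeZero n] (j : ℕ) (hj : j < n) :
    Good n hn (hU n j) (fun k => min j k) where
  bd f v hv := by
    rw [rep_hU, LinearMap.sum_apply]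
    refine Submodule.sum_mem _ fun A hA => ?_
    have cA := (Finset.mem_powersetCard.1 hA).2
    refine op_supp n _ (SS n f) (SS n (f + fun k => min j k)) (fun x hx y hy k => ?_) v hv
    have := word_Q_le n hn A (by omega) x y hy k
    rw [cA] at this
    exact this.trans (Nat.add_le_add_right (hx k) _)
  nn v hv x := by
    rw [rep_hU, LinearMap.sum_apply, Finsupp.finsetSum_apply]
    exact Finset.sum_nonneg fun A _ => op_nonneg n _ v hv x
  ex x := by
    obtain ⟨A, cA, y, hy, hQ⟩ := word_exists n hn j hj x
    refine ⟨y, hQ, fun v hv => ?_⟩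
    rw [rep_hU, LinearMap.sum_apply, Finsupp.finsetSum_apply]
    refine (op_ge n _ v hv x y hy).trans ?_
    exact Finset.single_le_sum (f := fun A => op (run n (word n A)) v y)
      (fun A _ => op_nonneg n _ v hv y) (Finset.mem_powersetCard.2 ⟨Finset.subset_univ _, cA⟩)

/-- the leading weight of a monomial -/
def wt (n : ℕ) (m : Fin (n - 1) →₀ ℕ) (k : ℕ) : ℕ := ∑ i : Fin (n - 1), m i * min (i.val + 1) k

/-- the ordered monomial -/
noncomputable def mon (n : ℕ) (m : Fin (n - 1) →₀ ℕ) : NilCox n :=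
  ((List.finRange (n - 1)).map fun i => hU n (i.val + 1) ^ m i).prod

lemma mon_good (n : ℕ) (hn : 3 ≤ n) [NeZero n] (m : Fin (n - 1) →₀ ℕ) :
    Good n hn (mon n m) (wt n m) := by
  have := Good.list (hn := hn) (List.finRange (n - 1)) (fun i => _root_.hU n (i.val + 1) ^ m i)
    (fun i => m i • fun k => min (i.val + 1) k)
    (fun i => (Good.hU n hn (i.val + 1) (by omega)).pow (m i))
  have e : wt n m = ((List.finRange (n - 1)).map
      (fun i => m i • fun k => min (i.val + 1) k)).sum := by
    funext k
    rw [← List.ofFn_eq_map, List.sum_ofFn]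
    simp [wt]
  rw [e]
  exact this

lemma wt_inj (n : ℕ) (m m' : Fin (n - 1) →₀ ℕ) (h : ∀ k < n + 1, wt n m k = wt n m' k) :
    m = m' := by
  have key : ∀ (m : Fin (n - 1) →₀ ℕ) (i : Fin (n - 1)),
      wt n m i.val + wt n m (i.val + 2) + m i = 2 * wt n m (i.val + 1) := by
    intro m i
    have : m i = ∑ l : Fin (n - 1), if l = i then m l else 0 := by simp
    rw [this]
    unfold wt
    rw [Finset.mul_sum, ← Finset.sum_add_distrib, ← Finset.sum_add_distrib]
    refine Finset.sum_congr rfl fun l _ => ?_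
    by_cases hl : l = i
    · subst hl
      simp only [if_true]
      rw [min_eq_right (by omega), min_eq_left (by omega), min_self]
      ring
    · have hl' : l.val ≠ i.val := fun h => hl (Fin.ext h)
      simp only [hl, if_false]
      rcases Nat.lt_or_gt_of_ne hl' with h | h
      · rw [min_eq_left (by omega), min_eq_left (by omega), min_eq_left (by omega)]; ring
      · rw [min_eq_right (by omega), min_eq_right (by omega), min_eq_right (by omega)]; ring
  ext i
  have a := key m i
  have b := key m' i
  have := i.2
  rw [h _ (by omega), h _ (by omega), h _ (by omega)] at a
  omega

lemma mon_indep (n : ℕ) (hn : 3 ≤ n) (P : MvPolynomial (Fin (n - 1)) ℂ)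
    (h : ∑ m ∈ P.support, MvPolynomial.coeff m P • rep n hn (mon n m) = 0) : P = 0 := by
  have : NeZero n := ⟨by omega⟩
  by_contra hP
  have hne : P.support.Nonempty := MvPolynomial.support_nonempty.2 hP
  obtain ⟨m, hm, hmax⟩ := Finset.exists_max_image P.support
    (fun m => ∑ k ∈ Finset.range (n + 1), wt n m k) hne
  let x0 : St n := (1, 0)
  have hx0 : ∀ k, Q n k x0 = 0 := by intro k; simp [Q, x0]
  let v : St n →₀ ℂ := Finsupp.single x0 1
  have hv : ∀ x, 0 ≤ v x := by
    classical
    intro x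
    simp only [v, Finsupp.single_apply]
    split_ifs
    · exact zero_le_one
    · exact le_rfl
  obtain ⟨y, hy, hy'⟩ := (mon_good n hn m).ex x0
  have hpos := hy' v hv
  have hne0 : rep n hn (mon n m) v y ≠ 0 := by
    intro h0
    rw [h0] at hpos
    simp [v] at hpos
    exact absurd hpos (not_le_of_gt zero_lt_one)
  have h2 := congrArg (fun g => g v y) h
  simp only [LinearMap.sum_apply, LinearMap.smul_apply,
    Finsupp.finsetSum_apply, Finsupp.smul_apply, LinearMap.zero_apply,
    Finsupp.zero_apply] at h2
  rw [Finset.sum_eq_single m] at h2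
  · rw [smul_eq_zero] at h2
    rcases h2 with h2 | h2
    · exact MvPolynomial.mem_support_iff.1 hm h2
    · exact hne0 h2
  · intro m' hm' hneq
    have : rep n hn (mon n m') v y = 0 := by
      by_contra hnz
      have hb := (mon_good n hn m').bd 0 v
        (Finsupp.single_mem_supported ℂ _ (fun k => (hx0 k).le))
      have hyS : y ∈ SS n (0 + wt n m') :=
        (Finsupp.mem_supported ℂ _).1 hb (Finsupp.mem_support_iff.2 hnz)
      have hle : ∀ k ∈ Finset.range (n + 1), wt n m k ≤ wt n m' k := by
        intro k _
        have := hyS k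
        rw [hy, hx0] at this
        simpa using this
      have heq := (Finset.sum_eq_sum_iff_of_le hle).1
        (le_antisymm (Finset.sum_le_sum hle) (hmax m' hm'))
      exact hneq (wt_inj n m m' fun k hk => heq k (Finset.mem_range.2 hk)).symm
    rw [this, smul_zero]
  · intro hcon
    exact absurd hm hcon

lemma evalH_eq (n : ℕ) (P : MvPolynomial (Fin (n - 1)) ℂ) (S : Finset (Fin (n - 1) →₀ ℕ))
    (hS : P.support ⊆ S) : evalH n P = ∑ m ∈ S, MvPolynomial.coeff m P • mon n m := by
  unfold evalH
  refine Finset.sum_subset hS fun m _ hm => ?_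
  rw [MvPolynomial.notMem_support_iff.1 hm, zero_smul]

end NilCoxProof

/-- The elements `h_1(u), …, h_{n-1}(u)` of the affine nilCoxeter algebra `U_n` are
algebraically independent over `ℂ`: the algebra homomorphism
`ℂ[X_1, …, X_{n-1}] → U_n`, `X_k ↦ h_k(u)`, is injective. -/
theorem hU_algebraically_independent (n : ℕ) (hn : 3 ≤ n) :
    Function.Injective (evalH n) := by
  classical
  intro P R h
  rw [← sub_eq_zero]
  apply NilCoxProof.mon_indep n hn
  have hs : (P - R).support ⊆ P.support ∪ R.support := MvPolynomial.support_sub _ P R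
  have h1 := NilCoxProof.evalH_eq n P _ (Finset.subset_union_left (s₂ := R.support))
  have h2 := NilCoxProof.evalH_eq n R _ (Finset.subset_union_right (s₁ := P.support))
  have h3 := congrArg (NilCoxProof.rep n hn) (h1.symm.trans (h.trans h2))
  simp only [map_sum, map_smul] at h3
  rw [Finset.sum_subset hs (fun m _ hm => by
    rw [MvPolynomial.notMem_support_iff.1 hm, zero_smul])]
  refine LinearMap.ext fun v => Finsupp.ext fun y => ?_
  have h4 := congrArg (fun g => g v y) h3
  simp only [LinearMap.sum_apply, LinearMap.smul_apply, Finsupp.finsetSum_apply,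
    Finsupp.smul_apply, smul_eq_mul] at h4
  simp only [LinearMap.sum_apply, LinearMap.smul_apply, Finsupp.finsetSum_apply,
    Finsupp.smul_apply, smul_eq_mul, LinearMap.zero_apply, Finsupp.zero_apply,
    MvPolynomial.coeff_sub, sub_mul, Finset.sum_sub_distrib]
  rw [h4, sub_self]
end

section
/- Each σ_i maps edge sequences to edge sequences, and the orbit of the edge sequence p^∅ of the empty partition under the group of permutations of edge sequences generated by {σ_i : i a residue mod n} is exactly the set of n-core edge sequences. -/
open scoped BigOperators

/-- The function underlying the simple reflection `s_i`: it interchanges `j` and `j + 1`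
for every `j ≡ i (mod n)` and fixes all other integers. -/
def sFun (n : ℕ) (i : ℤ) : ℤ → ℤ := fun j =>
  if (j - i) % (n : ℤ) = 0 then j + 1
  else if (j - i - 1) % (n : ℤ) = 0 then j - 1
  else j

/-- An edge sequence (of a partition): a doubly infinite `{0,1}`-sequence which is
eventually `1` to the left, eventually `0` to the right, and has as many `1`s in
positions `≥ 1` as `0`s in positions `≤ 0`. -/
def EdgeSeq (p : ℤ → Bool) : Prop :=
  (∃ N : ℤ, ∀ i ≤ N, p i = true) ∧ (∃ N : ℤ, ∀ i : ℤ, N ≤ i → p i = false) ∧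
    Set.ncard {i : ℤ | 1 ≤ i ∧ p i = true} = Set.ncard {i : ℤ | i ≤ 0 ∧ p i = false}

/-- The involution `σᵢ` of bit sequences interchanging the values at positions `kn + i`
and `kn + i + 1` for every `k ∈ ℤ`. -/
def sigmaAct (n : ℕ) (i : ℤ) (p : ℤ → Bool) : ℤ → Bool := fun j => p (sFun n i j)

/-- The edge sequence `p^∅` of the empty partition. -/
def emptyES : ℤ → Bool := fun i => decide (i ≤ 0)

/-- The result of applying the word `σ_{ρ₁}, σ_{ρ₂}, …` of generators successively to a
bit sequence; the orbit of `p` under the group generated by the `σᵢ` is the set of all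
such results (each `σᵢ` being an involution). -/
def applyWord (n : ℕ) (ρ : List (ZMod n)) (p : ℤ → Bool) : ℤ → Bool :=
  ρ.foldl (fun q i => sigmaAct n (i.val : ℤ) q) p

theorem dvd_absurd1 {n : ℕ} (hn : 3 ≤ n) {x y : ℤ} (hx : (n : ℤ) ∣ x) (hy : (n : ℤ) ∣ y)
    (h : x - y = 1) : False := by
  have h1 : (n : ℤ) ∣ 1 := h ▸ dvd_sub hx hy
  have := Int.le_of_dvd one_pos h1
  omega

theorem dvd_absurd2 {n : ℕ} (hn : 3 ≤ n) {x y : ℤ} (hx : (n : ℤ) ∣ x) (hy : (n : ℤ) ∣ y)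
    (h : x - y = 2) : False := by
  have h1 : (n : ℤ) ∣ 2 := h ▸ dvd_sub hx hy
  have := Int.le_of_dvd two_pos h1
  omega

theorem sFun_lo {n : ℕ} {i j : ℤ} (h : (n : ℤ) ∣ j - i) : sFun n i j = j + 1 := by
  unfold sFun
  rw [if_pos (Int.emod_eq_zero_of_dvd h)]

theorem sFun_hi {n : ℕ} (hn : 3 ≤ n) {i j : ℤ} (h : (n : ℤ) ∣ j - i - 1) :
    sFun n i j = j - 1 := by
  unfold sFun
  rw [if_neg, if_pos (Int.emod_eq_zero_of_dvd h)]
  intro h2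
  exact dvd_absurd1 hn (Int.dvd_of_emod_eq_zero h2) h (by ring)

theorem sFun_mid {n : ℕ} {i j : ℤ} (h : ¬ (n : ℤ) ∣ j - i) (h' : ¬ (n : ℤ) ∣ j - i - 1) :
    sFun n i j = j := by
  unfold sFun
  rw [if_neg, if_neg]
  · exact fun h2 => h' (Int.dvd_of_emod_eq_zero h2)
  · exact fun h2 => h (Int.dvd_of_emod_eq_zero h2)

theorem sFun_invol {n : ℕ} (hn : 3 ≤ n) (i j : ℤ) : sFun n i (sFun n i j) = j := by
  by_cases h : (n : ℤ) ∣ j - i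
  · rw [sFun_lo h, sFun_hi hn (by convert h using 1; ring)]; ring
  · by_cases h' : (n : ℤ) ∣ j - i - 1
    · rw [sFun_hi hn h', sFun_lo (by convert h' using 1; ring)]; ring
    · rw [sFun_mid h h', sFun_mid h h']

theorem sFun_add_mul {n : ℕ} (i j k : ℤ) : sFun n i (j + n * k) = sFun n i j + n * k := by
  unfold sFun
  rw [show j + n * k - i - 1 = (j - i - 1) + n * k by ring,
    show j + n * k - i = (j - i) + n * k by ring, Int.add_mul_emod_self_left,
    Int.add_mul_emod_self_left]
  split_ifs <;> ring

theorem sFun_add {n : ℕ} (i j : ℤ) : sFun n i (j + n) = sFun n i j + n := by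
  simpa using sFun_add_mul (n := n) i j 1

theorem sFun_emod {n : ℕ} (i : ℤ) : sFun n (i % n) = sFun n i := by
  funext j
  unfold sFun
  rw [show (j - i % n) % (n : ℤ) = (j - i) % n by simp [Int.sub_emod],
    show (j - i % n - 1) % (n : ℤ) = (j - i - 1) % n by
      rw [show j - i % n - 1 = (j - 1) - i % n by ring, show j - i - 1 = (j - 1) - i by ring]
      rw [Int.sub_emod (j - 1) (i % n), Int.emod_emod, ← Int.sub_emod]]

theorem sFun_bounds (n : ℕ) (i j : ℤ) : j - 1 ≤ sFun n i j ∧ sFun n i j ≤ j + 1 := by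
  unfold sFun
  split_ifs <;> omega

theorem sFun_window {n : ℕ} (hn : 3 ≤ n) {i a b j : ℤ} (ha : (n : ℤ) ∣ a - i + 1)
    (hb : (n : ℤ) ∣ b - i + 1) (hj : a < j ∧ j ≤ b) : a < sFun n i j ∧ sFun n i j ≤ b := by
  by_cases h : (n : ℤ) ∣ j - i
  · rw [sFun_lo h]
    have : j ≠ b := by
      rintro rfl
      exact dvd_absurd1 hn hb h (by ring)
    omega
  · by_cases h' : (n : ℤ) ∣ j - i - 1
    · rw [sFun_hi hn h']
      have : j ≠ a + 1 := by
        rintro rfl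
        exact dvd_absurd1 hn ha h' (by ring)
      omega
    · rw [sFun_mid h h']; exact hj

theorem ncard_window (p : ℤ → Bool) (a b : ℤ) (ha : a ≤ 0) (hb : 0 ≤ b)
    (h1 : ∀ i ≤ a, p i = true) (h2 : ∀ i : ℤ, b < i → p i = false) :
    ((Finset.Ioc a b).filter (fun j => p j = true)).card +
      Set.ncard {i : ℤ | i ≤ 0 ∧ p i = false} =
    Set.ncard {i : ℤ | 1 ≤ i ∧ p i = true} + (-a).toNat := by
  have hA : {i : ℤ | 1 ≤ i ∧ p i = true} =
      ((Finset.Ioc 0 b).filter (fun j => p j = true) : Finset ℤ) := by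
    ext j
    simp only [Set.mem_ofPred_eq, Finset.coe_filter, Finset.mem_Ioc]
    constructor
    · rintro ⟨h, h'⟩
      refine ⟨⟨by omega, ?_⟩, h'⟩
      by_contra hc
      rw [h2 j (by omega)] at h'
      exact absurd h' (by simp)
    · rintro ⟨h, h'⟩
      exact ⟨by omega, h'⟩
  have hB : {i : ℤ | i ≤ 0 ∧ p i = false} =
      ((Finset.Ioc a 0).filter (fun j => ¬ p j = true) : Finset ℤ) := by
    ext j
    simp only [Set.mem_ofPred_eq, Finset.coe_filter, Finset.mem_Ioc, Bool.not_eq_true]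
    constructor
    · rintro ⟨h, h'⟩
      refine ⟨⟨?_, h⟩, h'⟩
      by_contra hc
      rw [h1 j (by omega)] at h'
      exact absurd h' (by simp)
    · rintro ⟨h, h'⟩
      exact ⟨by omega, h'⟩
  rw [hA, hB, Set.ncard_coe_finset, Set.ncard_coe_finset]
  have hu : Finset.Ioc a b = Finset.Ioc a 0 ∪ Finset.Ioc 0 b := by
    ext j; simp only [Finset.mem_union, Finset.mem_Ioc]; omega
  have hd : Disjoint (Finset.Ioc a 0) (Finset.Ioc 0 b) := by
    rw [Finset.disjoint_left]; intro j; simp only [Finset.mem_Ioc]; omega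
  rw [hu, Finset.filter_union, Finset.card_union_of_disjoint (Finset.disjoint_filter_filter hd)]
  have h3 := Finset.card_filter_add_card_filter_not (s := Finset.Ioc a 0) (fun j => p j = true)
  rw [Int.card_Ioc, zero_sub] at h3
  omega

theorem edgeSeq_sigma {n : ℕ} (hn : 3 ≤ n) (i : ℤ) (p : ℤ → Bool) (hp : EdgeSeq p) :
    EdgeSeq (sigmaAct n i p) := by
  obtain ⟨⟨A, hA⟩, ⟨B, hB⟩, hc⟩ := hp
  -- aligned window
  let K : ℤ := |A| + |B| + |i| + 2
  have hA' := neg_abs_le A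
  have hA2 := abs_nonneg A
  have hB' := le_abs_self B
  have hB2 := abs_nonneg B
  have hi1 := neg_abs_le i
  have hi2 := le_abs_self i
  have hK : K = |A| + |B| + |i| + 2 := rfl
  have hK' : K ≤ n * K := by nlinarith
  have ha : i - 1 - n * K ≤ A - 1 ∧ i - 1 - n * K ≤ 0 := by constructor <;> omega
  have hb : B + 1 ≤ i - 1 + n * K + 1 ∧ 0 ≤ i - 1 + n * K ∧ B ≤ i - 1 + n * K:= by
    refine ⟨?_, ?_, ?_⟩ <;> omega
  have hda : (n : ℤ) ∣ (i - 1 - n * K) - i + 1 := ⟨-K, by ring⟩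
  have hdb : (n : ℤ) ∣ (i - 1 + n * K) - i + 1 := ⟨K, by ring⟩
  generalize i - 1 - n * K = a at *
  generalize i - 1 + n * K = b at *
  have h1 : ∀ j ≤ a, sigmaAct n i p j = true := fun j hj =>
    hA _ (by have := sFun_bounds n i j; omega)
  have h2 : ∀ j : ℤ, b < j → sigmaAct n i p j = false := fun j hj =>
    hB _ (by have := sFun_bounds n i j; omega)
  refine ⟨⟨a, h1⟩, ⟨b + 1, fun j hj => h2 j (by omega)⟩, ?_⟩
  have e1 := ncard_window p a b ha.2 hb.2.1 (fun j hj => hA j (by omega))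
    (fun j hj => hB j (by omega))
  have e2 := ncard_window (sigmaAct n i p) a b ha.2 hb.2.1 h1 h2
  have e3 : ((Finset.Ioc a b).filter (fun j => sigmaAct n i p j = true)).card =
      ((Finset.Ioc a b).filter (fun j => p j = true)).card := by
    refine Finset.card_bij' (fun j _ => sFun n i j) (fun j _ => sFun n i j) ?_ ?_ ?_ ?_
    · intro j hj
      simp only [Finset.mem_filter, Finset.mem_Ioc] at hj ⊢
      exact ⟨sFun_window hn hda hdb hj.1, hj.2⟩
    · intro j hj
      simp only [Finset.mem_filter, Finset.mem_Ioc] at hj ⊢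
      refine ⟨sFun_window hn hda hdb hj.1, ?_⟩
      unfold sigmaAct
      rw [sFun_invol hn]; exact hj.2
    · intro j _; exact sFun_invol hn i j
    · intro j _; exact sFun_invol hn i j
  omega

def IsCoreSeq (n : ℕ) (p : ℤ → Bool) : Prop :=
  ∀ i : ℤ, ¬(p i = false ∧ p (i + (n : ℤ)) = true)

theorem core_sigma {n : ℕ} (i : ℤ) {p : ℤ → Bool} (hp : IsCoreSeq n p) :
    IsCoreSeq n (sigmaAct n i p) := by
  intro j
  unfold sigmaAct
  rw [sFun_add]
  exact hp _

theorem core_false {n : ℕ} {p : ℤ → Bool} (hp : IsCoreSeq n p) {j : ℤ} (hj : p j = false)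
    (k : ℕ) : p (j + n * k) = false := by
  induction k with
  | zero => simpa using hj
  | succ k ih =>
    by_contra h
    apply hp (j + n * k)
    refine ⟨ih, ?_⟩
    rw [Bool.not_eq_false] at h
    rw [← h]; congr 1; push_cast; ring

theorem core_true {n : ℕ} {p : ℤ → Bool} (hp : IsCoreSeq n p) {j : ℤ} (hj : p j = true)
    (k : ℕ) : p (j - n * k) = true := by
  by_contra h
  rw [Bool.not_eq_true] at h
  have := core_false hp h k
  rw [sub_add_cancel, hj] at this
  exact absurd this (by simp)

theorem core_pair {n : ℕ} {p : ℤ → Bool} (hp : IsCoreSeq n p) {i : ℤ}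
    (h0 : p i = false) (h1 : p (i + 1) = true) {j : ℤ} (hj : (n : ℤ) ∣ j - i) :
    p (j + 1) = false → p j = false := by
  intro h
  obtain ⟨k, hk⟩ := hj
  rcases le_total 0 k with hk0 | hk0
  · have := core_false hp h0 k.toNat
    rw [Int.toNat_of_nonneg hk0] at this
    rw [← this]; congr 1; omega
  · have := core_true hp h1 (-k).toNat
    rw [Int.toNat_of_nonneg (by omega), show i + 1 - n * -k = j + 1 by linarith, h] at this
    exact absurd this (by simp)

/-- The measure. -/
noncomputable def wt (a b : ℤ) (p : ℤ → Bool) : ℕ :=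
  ∑ j ∈ (Finset.Ioc a b).filter (fun j => p j = true), (j - a).toNat

/-- Where a bead goes. -/
def gFun (n : ℕ) (i : ℤ) (p : ℤ → Bool) (j : ℤ) : ℤ :=
  if (j - i - 1) % (n : ℤ) = 0 ∧ p (j - 1) = false then j - 1 else j

theorem core_window {n : ℕ} (hn : 3 ≤ n) {p : ℤ → Bool} (hp : IsCoreSeq n p) {i a b : ℤ}
    (h0 : p i = false) (h1 : p (i + 1) = true)
    (ha : ∀ j ≤ a, p j = true) (hb : ∀ j : ℤ, b < j → p j = false) :
    (∀ j ≤ a, sigmaAct n i p j = true) ∧ (∀ j : ℤ, b < j → sigmaAct n i p j = false) := by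
  have key := @core_pair n p hp i h0 h1
  constructor
  · intro j hj
    unfold sigmaAct
    by_cases h : (n : ℤ) ∣ j - i
    · rw [sFun_lo h]
      by_contra hc
      have := key h (by simpa using hc)
      rw [ha j hj] at this
      exact absurd this (by simp)
    · by_cases h' : (n : ℤ) ∣ j - i - 1
      · rw [sFun_hi hn h']; exact ha _ (by omega)
      · rw [sFun_mid h h']; exact ha _ hj
  · intro j hj
    unfold sigmaAct
    by_cases h : (n : ℤ) ∣ j - i
    · rw [sFun_lo h]; exact hb _ (by omega)
    · by_cases h' : (n : ℤ) ∣ j - i - 1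
      · rw [sFun_hi hn h']
        apply key (by convert h' using 1; ring)
        rw [sub_add_cancel]; exact hb _ hj
      · rw [sFun_mid h h']; exact hb _ hj

theorem wt_lt {n : ℕ} (hn : 3 ≤ n) {p : ℤ → Bool} (hp : IsCoreSeq n p) {i a b : ℤ}
    (h0 : p i = false) (h1 : p (i + 1) = true)
    (ha : ∀ j ≤ a, p j = true) (hb : ∀ j : ℤ, b < j → p j = false) :
    wt a b (sigmaAct n i p) < wt a b p := by
  have key := @core_pair n p hp i h0 h1
  obtain ⟨wa, wb⟩ := core_window hn hp h0 h1 ha hb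
  -- trichotomy description of `sigmaAct`
  have hlo : ∀ j, (n : ℤ) ∣ j - i → sigmaAct n i p j = p (j + 1) := fun j h => by
    unfold sigmaAct; rw [sFun_lo h]
  have hhi : ∀ j, (n : ℤ) ∣ j - i - 1 → sigmaAct n i p j = p (j - 1) := fun j h => by
    unfold sigmaAct; rw [sFun_hi hn h]
  have hmid : ∀ j, ¬ (n : ℤ) ∣ j - i → ¬ (n : ℤ) ∣ j - i - 1 → sigmaAct n i p j = p j :=
    fun j h h' => by unfold sigmaAct; rw [sFun_mid h h']
  have g1 : ∀ j, (n : ℤ) ∣ j - i - 1 → p (j - 1) = false → gFun n i p j = j - 1 :=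
    fun j h h' => by unfold gFun; rw [if_pos ⟨Int.emod_eq_zero_of_dvd h, h'⟩]
  have g2 : ∀ j, ¬ ((n : ℤ) ∣ j - i - 1 ∧ p (j - 1) = false) → gFun n i p j = j :=
    fun j h => by
      unfold gFun; rw [if_neg]; rintro ⟨h2, h3⟩
      exact h ⟨Int.dvd_of_emod_eq_zero h2, h3⟩
  have gle : ∀ j, gFun n i p j ≤ j := fun j => by unfold gFun; split_ifs <;> omega
  have gmem : ∀ j, p j = true → sigmaAct n i p (gFun n i p j) = true := by
    intro j hj
    by_cases h : (n : ℤ) ∣ j - i - 1 ∧ p (j - 1) = false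
    · rw [g1 j h.1 h.2, hlo _ (by convert h.1 using 1; ring), sub_add_cancel, hj]
    · rw [g2 j h]
      by_cases h' : (n : ℤ) ∣ j - i - 1
      · rw [hhi j h']
        by_contra hc
        exact h ⟨h', by simpa using hc⟩
      · by_cases h'' : (n : ℤ) ∣ j - i
        · rw [hlo j h'']
          by_contra hc
          have := key h'' (by simpa using hc)
          rw [hj] at this
          exact absurd this (by simp)
        · rw [hmid j h'' h', hj]
  have ginj : ∀ j k, p j = true → p k = true → gFun n i p j = gFun n i p k → j = k := by
    intro j k hj hk
    by_cases h : (n : ℤ) ∣ j - i - 1 ∧ p (j - 1) = false <;>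
    by_cases h' : (n : ℤ) ∣ k - i - 1 ∧ p (k - 1) = false
    · rw [g1 j h.1 h.2, g1 k h'.1 h'.2]; omega
    · rw [g1 j h.1 h.2, g2 k h']
      rintro rfl
      rw [h.2] at hk; exact absurd hk (by simp)
    · rw [g1 k h'.1 h'.2, g2 j h]
      rintro rfl
      rw [h'.2] at hj; exact absurd hj (by simp)
    · rw [g2 j h, g2 k h']; exact id
  have gsurj : ∀ k, sigmaAct n i p k = true → ∃ j, p j = true ∧ gFun n i p j = k := by
    intro k hk
    by_cases h : (n : ℤ) ∣ k - i
    · rw [hlo k h] at hk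
      have hd : (n : ℤ) ∣ k + 1 - i - 1 := by convert h using 1; ring
      cases hpk : p k
      · exact ⟨k + 1, hk, by rw [g1 _ hd (by simpa using hpk)]; ring⟩
      · refine ⟨k, hpk, g2 k ?_⟩
        rintro ⟨h3, -⟩
        exact dvd_absurd1 hn h h3 (by ring)
    · by_cases h' : (n : ℤ) ∣ k - i - 1
      · rw [hhi k h'] at hk
        refine ⟨k, ?_, g2 k (by simp [hk])⟩
        by_contra hc
        have := key (j := k - 1) (by convert h' using 1; ring) (by simpa using hc)
        rw [hk] at this
        exact absurd this (by simp)
      · rw [hmid k h h'] at hk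
        exact ⟨k, hk, g2 k (fun h3 => h' h3.1)⟩
  have inwin : ∀ q : ℤ → Bool, (∀ j : ℤ, b < j → q j = false) → ∀ j, q j = true → j ≤ b := by
    intro q hq j hj
    by_contra hc
    rw [hq j (by omega)] at hj
    exact absurd hj (by simp)
  have glow : ∀ j, a < j → a < gFun n i p j := by
    intro j hj
    by_cases h : (n : ℤ) ∣ j - i - 1 ∧ p (j - 1) = false
    · rw [g1 j h.1 h.2]
      by_contra hc
      have := ha (j - 1) (by omega)
      rw [h.2] at this
      exact absurd this (by simp)
    · rw [g2 j h]; exact hj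
  have e : wt a b (sigmaAct n i p) =
      ∑ j ∈ (Finset.Ioc a b).filter (fun j => p j = true), (gFun n i p j - a).toNat := by
    unfold wt
    symm
    refine Finset.sum_bij (fun j _ => gFun n i p j) ?_ ?_ ?_ ?_
    · intro j hj
      simp only [Finset.mem_filter, Finset.mem_Ioc] at hj ⊢
      exact ⟨⟨glow j hj.1.1, (gle j).trans hj.1.2⟩, gmem j hj.2⟩
    · intro j hj k hk
      simp only [Finset.mem_filter] at hj hk
      exact ginj j k hj.2 hk.2
    · intro k hk
      simp only [Finset.mem_filter, Finset.mem_Ioc] at hk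
      obtain ⟨j, hj, rfl⟩ := gsurj k hk.2
      refine ⟨j, ?_, rfl⟩
      simp only [Finset.mem_filter, Finset.mem_Ioc]
      exact ⟨⟨lt_of_lt_of_le hk.1.1 (gle j), inwin p hb j hj⟩, hj⟩
    · intro j _; rfl
  rw [e]
  unfold wt
  have hai : a < i := by
    by_contra hc
    rw [ha i (by omega)] at h0
    exact absurd h0 (by simp)
  refine Finset.sum_lt_sum (fun j _ => ?_) ⟨i + 1, ?_, ?_⟩
  · have := gle j
    omega
  · simp only [Finset.mem_filter, Finset.mem_Ioc]
    exact ⟨⟨by omega, inwin p hb _ h1⟩, h1⟩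
  · rw [g1 (i + 1) (by simp) (by simpa using h0)]
    omega

theorem eq_empty_of_no_inv {p : ℤ → Bool} (hp : EdgeSeq p)
    (h : ∀ i, ¬ (p i = false ∧ p (i + 1) = true)) : p = emptyES := by
  obtain ⟨⟨A, hA⟩, ⟨B, hB⟩, hc⟩ := hp
  have hf : ∀ i, p i = false → ∀ k : ℕ, p (i + k) = false := by
    intro i hi k
    induction k with
    | zero => simpa using hi
    | succ k ih =>
      by_contra hk
      refine h (i + k) ⟨ih, ?_⟩
      rw [Bool.not_eq_false] at hk
      rw [← hk]; congr 1; push_cast; ring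
  have hf' : ∀ i j, p i = false → i ≤ j → p j = false := by
    intro i j hi hij
    have := hf i hi (j - i).toNat
    rw [← this]; congr 1; omega
  have fin1 : {i : ℤ | 1 ≤ i ∧ p i = true}.Finite := by
    refine (Set.finite_Icc 1 B).subset ?_
    rintro j ⟨h1, h2⟩
    refine ⟨h1, ?_⟩
    by_contra hcon
    rw [hB j (by omega)] at h2
    exact absurd h2 (by simp)
  have fin2 : {i : ℤ | i ≤ 0 ∧ p i = false}.Finite := by
    refine (Set.finite_Icc A 0).subset ?_
    rintro j ⟨h1, h2⟩
    refine ⟨?_, h1⟩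
    by_contra hcon
    rw [hA j (by omega)] at h2
    exact absurd h2 (by simp)
  have hp0 : p 0 = true := by
    by_contra h0
    rw [Bool.not_eq_true] at h0
    have hemp : {i : ℤ | 1 ≤ i ∧ p i = true} = ∅ := by
      ext j
      simp only [Set.mem_ofPred_eq, Set.mem_empty_iff_false, iff_false]
      rintro ⟨h1, h2⟩
      rw [hf' 0 j h0 (by omega)] at h2
      exact absurd h2 (by simp)
    rw [hemp, Set.ncard_empty, eq_comm, Set.ncard_eq_zero fin2] at hc
    have : (0 : ℤ) ∈ {i : ℤ | i ≤ 0 ∧ p i = false} := ⟨le_rfl, h0⟩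
    rw [hc] at this
    exact this
  have hneg : ∀ j ≤ 0, p j = true := by
    intro j hj
    by_contra hcon
    rw [hf' j 0 (by simpa using hcon) hj] at hp0
    exact absurd hp0 (by simp)
  have hemp : {i : ℤ | i ≤ 0 ∧ p i = false} = ∅ := by
    ext j
    simp only [Set.mem_ofPred_eq, Set.mem_empty_iff_false, iff_false]
    rintro ⟨h1, h2⟩
    rw [hneg j h1] at h2
    exact absurd h2 (by simp)
  rw [hemp, Set.ncard_empty, Set.ncard_eq_zero fin1] at hc
  funext j
  unfold emptyES
  by_cases hj : j ≤ 0
  · simp [hj, hneg j hj]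
  · have : j ∉ {i : ℤ | 1 ≤ i ∧ p i = true} := by rw [hc]; simp
    simp only [Set.mem_ofPred_eq, not_and, Bool.not_eq_true] at this
    simp [hj, this (by omega)]

theorem core_reach {n : ℕ} (hn : 3 ≤ n) (a b : ℤ) : ∀ (m : ℕ) (p : ℤ → Bool), wt a b p = m →
    EdgeSeq p → IsCoreSeq n p → (∀ j ≤ a, p j = true) → (∀ j : ℤ, b < j → p j = false) →
    ∃ ρ : List (ZMod n), p = applyWord n ρ emptyES := by
  intro m
  induction m using Nat.strong_induction_on with
  | _ m ih =>
    intro p hm hE hC ha hb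
    by_cases h : ∀ i, ¬ (p i = false ∧ p (i + 1) = true)
    · exact ⟨[], eq_empty_of_no_inv hE h⟩
    · push Not at h
      obtain ⟨i, h0, h1⟩ := h
      obtain ⟨wa, wb⟩ := core_window hn hC h0 h1 ha hb
      obtain ⟨ρ, hρ⟩ := ih _ (hm ▸ wt_lt hn hC h0 h1 ha hb) _ rfl (edgeSeq_sigma hn i p hE)
        (core_sigma i hC) wa wb
      refine ⟨ρ ++ [(i : ZMod n)], ?_⟩
      have : NeZero n := ⟨by omega⟩
      unfold applyWord at hρ ⊢
      rw [List.foldl_append, ← hρ, List.foldl_cons, List.foldl_nil, ZMod.val_intCast]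
      funext j
      unfold sigmaAct
      rw [sFun_emod, sFun_invol hn]

theorem edgeSeq_empty : EdgeSeq emptyES := by
  unfold EdgeSeq emptyES
  refine ⟨⟨0, fun i hi => by simpa using hi⟩, ⟨1, fun i hi => by simp; omega⟩, ?_⟩
  have e1 : {i : ℤ | 1 ≤ i ∧ decide (i ≤ 0) = true} = ∅ := by
    ext j; simp; omega
  have e2 : {i : ℤ | i ≤ 0 ∧ decide (i ≤ 0) = false} = ∅ := by
    ext j; simp
  rw [e1, e2]

theorem core_empty (n : ℕ) : IsCoreSeq n emptyES := by
  intro i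
  unfold emptyES
  simp
  omega

theorem applyWord_core {n : ℕ} (hn : 3 ≤ n) (ρ : List (ZMod n)) : ∀ p : ℤ → Bool,
    EdgeSeq p → IsCoreSeq n p → EdgeSeq (applyWord n ρ p) ∧ IsCoreSeq n (applyWord n ρ p) := by
  unfold applyWord
  induction ρ with
  | nil => intro p h h'; exact ⟨h, h'⟩
  | cons i ρ ih =>
    intro p h h'
    exact ih _ (edgeSeq_sigma hn _ p h) (core_sigma _ h')

/-- Each `σᵢ` maps edge sequences to edge sequences, and the orbit of the edge sequence
of the empty partition under the group generated by `{σᵢ : i mod n}` is exactly the set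
of `n`-core edge sequences, i.e. those edge sequences `p` with no index `i` such that
`pᵢ = 0` and `p_{i+n} = 1`. -/
theorem sigma_orbit_empty_eq_ncores (n : ℕ) (hn : 3 ≤ n) :
    (∀ (i : ℤ) (p : ℤ → Bool), EdgeSeq p → EdgeSeq (sigmaAct n i p)) ∧
      {p : ℤ → Bool | ∃ ρ : List (ZMod n), p = applyWord n ρ emptyES} =
        {p : ℤ → Bool | EdgeSeq p ∧
          ∀ i : ℤ, ¬(p i = false ∧ p (i + (n : ℤ)) = true)} := by
  refine ⟨fun i p hp => edgeSeq_sigma hn i p hp, ?_⟩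
  ext p
  constructor
  · rintro ⟨ρ, rfl⟩
    exact applyWord_core hn ρ _ edgeSeq_empty (core_empty n)
  · rintro ⟨hE, hC⟩
    obtain ⟨⟨A, hA⟩, ⟨B, hB⟩, -⟩ := id hE
    exact core_reach hn A B _ p rfl hE hC hA (fun j hj => hB j hj.le)
end

section
/- In the algebra Ũ_n, the elements h̃_0, h̃_1, …, h̃_{n−1} pairwise commute: h̃_k h̃_l = h̃_l h̃_k for all 0 ≤ k, l ≤ n−1. (Consequently the affine stable Grothendieck polynomials G̃_w are symmetric functions.) -/
open scoped BigOperators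

/-- The defining relations of the algebra `Ũ_n`: `uᵢ² = uᵢ`, the braid relations
`uᵢ u_{i+1} uᵢ = u_{i+1} uᵢ u_{i+1}`, and commutation `uᵢ uⱼ = uⱼ uᵢ` whenever
`i - j ≢ ±1 (mod n)`. -/
inductive GrothRel (n : ℕ) : FreeAlgebra ℂ (ZMod n) → FreeAlgebra ℂ (ZMod n) → Prop
  | sq (i : ZMod n) : GrothRel n (FreeAlgebra.ι ℂ i * FreeAlgebra.ι ℂ i) (FreeAlgebra.ι ℂ i)
  | braid (i : ZMod n) :
      GrothRel n (FreeAlgebra.ι ℂ i * FreeAlgebra.ι ℂ (i + 1) * FreeAlgebra.ι ℂ i)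
        (FreeAlgebra.ι ℂ (i + 1) * FreeAlgebra.ι ℂ i * FreeAlgebra.ι ℂ (i + 1))
  | comm (i j : ZMod n) (h1 : i - j ≠ 1) (h2 : j - i ≠ 1) :
      GrothRel n (FreeAlgebra.ι ℂ i * FreeAlgebra.ι ℂ j)
        (FreeAlgebra.ι ℂ j * FreeAlgebra.ι ℂ i)

/-- The algebra `Ũ_n`: the quotient of the free associative `ℂ`-algebra on
`u_0, …, u_{n-1}` by the defining relations (with `uᵢ² = uᵢ`). -/
abbrev Groth (n : ℕ) := RingQuot (GrothRel n)

/-- The generator `uᵢ` of `Ũ_n`. -/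
noncomputable def uGT (n : ℕ) (i : ZMod n) : Groth n :=
  RingQuot.mkAlgHom ℂ (GrothRel n) (FreeAlgebra.ι ℂ i)

/-- A residue mod `n` not belonging to `A` (the one with least representative), used to
linearise the cyclic order on `A`. -/
def missT (n : ℕ) (A : Finset (ZMod n)) : ZMod n :=
  ((((List.range n).find? fun k : ℕ => decide (((k : ℕ) : ZMod n) ∉ A)).getD 0 : ℕ) : ZMod n)

/-- `u_A`: the product of the `u_a` for `a ∈ A` in cyclically decreasing order, i.e. an
order in which `i + 1` precedes `i` whenever both lie in `A`. -/
noncomputable def uAT (n : ℕ) (A : Finset (ZMod n)) : Groth n :=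
  ((A.toList.insertionSort fun x y => (y - missT n A).val ≤ (x - missT n A).val).map
    (uGT n)).prod

/-- `h̃_k = ∑_{A ⊆ ℤ/n, |A| = k} u_A` in `Ũ_n`. -/
noncomputable def hT (n : ℕ) (k : ℕ) : Groth n :=
  ∑ A ∈ Finset.powersetCard k ((Finset.range n).image (Nat.cast : ℕ → ZMod n)), uAT n A

section Lin
variable {R : Type*} [Ring R] [Algebra ℂ R]

/-- Local factor attached to a site: free, forced in, forced out. -/
noncomputable def facG (x : ℂ) (v : R) : Option Bool → R
  | none => 1 + x • v
  | some true => x • v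
  | some false => 1

/-- Decreasing ordered product of local factors. -/
noncomputable def FG (v : ℕ → R) (c : ℕ → Option Bool) (x : ℂ) : ℕ → R
  | 0 => 1
  | m + 1 => facG x (v m) (c m) * FG v c x m

theorem FG_split (v : ℕ → R) (c : ℕ → Option Bool) (x : ℂ) (a b : ℕ) :
    FG v c x (a + b) = FG (fun j => v (a + j)) (fun j => c (a + j)) x b * FG v c x a := by
  induction b with
  | zero => simp [FG]
  | succ b ih => rw [← add_assoc]; simp only [FG]; rw [ih, mul_assoc]

theorem FG_congr {v w : ℕ → R} {c d : ℕ → Option Bool} (x : ℂ) (m : ℕ)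
    (h : ∀ i < m, v i = w i) (h' : ∀ i < m, c i = d i) : FG v c x m = FG w d x m := by
  induction m with
  | zero => rfl
  | succ m ih =>
    simp only [FG]
    rw [ih (fun i hi => h i (by omega)) (fun i hi => h' i (by omega)), h m (by omega),
      h' m (by omega)]

theorem facG_commute {x y : ℂ} {v w : R} {c d : Option Bool}
    (h : Commute v w ∨ c = some false ∨ d = some false) :
    Commute (facG x v c) (facG y w d) := by
  rcases h with h | h | h
  · have h1 : Commute (x • v) (y • w) := (h.smul_left x).smul_right y
    rcases c with _ | _ | _ <;> rcases d with _ | _ | _ <;> simp only [facG]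
    · exact ((Commute.one_left _).add_left ((Commute.one_right _).add_right h1))
    · exact Commute.one_right _
    · exact ((Commute.one_left _).add_left h1)
    · exact Commute.one_left _
    · exact Commute.one_left _
    · exact Commute.one_left _
    · exact ((Commute.one_right _).add_right h1)
    · exact Commute.one_right _
    · exact h1
  · subst h; exact Commute.one_left _
  · subst h; exact Commute.one_right _

theorem FG_commute {v w : ℕ → R} {c d : ℕ → Option Bool} {x y : ℂ} {a b : ℕ}
    (h : ∀ i < a, ∀ j < b, Commute (v i) (w j) ∨ c i = some false ∨ d j = some false) :
    Commute (FG v c x a) (FG w d y b) := by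
  induction a with
  | zero => exact Commute.one_left _
  | succ a ih =>
    simp only [FG]
    refine Commute.mul_left ?_ (ih fun i hi => h i (by omega))
    clear ih
    induction b with
    | zero => exact Commute.one_right _
    | succ b ih =>
      simp only [FG]
      exact Commute.mul_right (facG_commute (h a (by omega) b (by omega)))
        (ih fun i hi j hj => h i hi j (by omega))

theorem FG_true (v : ℕ → R) (c : ℕ → Option Bool) (x : ℂ) (m : ℕ)
    (h : ∀ i < m, c i = some true) : FG v c x m = x ^ m • FG v c 1 m := by
  induction m with
  | zero => simp [FG]
  | succ m ih =>
    simp only [FG]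
    rw [ih (fun i hi => h i (by omega)), h m (by omega)]
    simp only [facG, one_smul, smul_mul_smul_comm]
    rw [pow_succ']

theorem FG_false_one (v : ℕ → R) (c : ℕ → Option Bool) (x : ℂ) (h : c 0 = some false) :
    FG v c x 1 = 1 := by
  simp [FG, h, facG]

theorem FG_false_true (v : ℕ → R) (c : ℕ → Option Bool) (x : ℂ) (m : ℕ)
    (h0 : c 0 = some false) (h : ∀ i < m, c (1 + i) = some true) :
    FG v c x (1 + m) = x ^ m • FG v c 1 (1 + m) := by
  rw [FG_split, FG_split, FG_true _ _ _ _ h, FG_false_one _ _ _ h0, FG_false_one _ _ _ h0,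
    mul_one, mul_one]

theorem FG_true_false (v : ℕ → R) (c : ℕ → Option Bool) (x : ℂ) (m : ℕ)
    (h0 : c m = some false) (h : ∀ i < m, c i = some true) :
    FG v c x (m + 1) = x ^ m • FG v c 1 (m + 1) := by
  simp only [FG, h0, facG, one_mul]
  exact FG_true _ _ _ _ h

theorem FG_add (v : ℕ → R) (c d e : ℕ → Option Bool) (x : ℂ) (m k : ℕ) (hk : k < m)
    (hc : c k = none) (hd : d k = some true) (he : e k = some false)
    (hcd : ∀ i, i < m → i ≠ k → d i = c i) (hce : ∀ i, i < m → i ≠ k → e i = c i) :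
    FG v c x m = FG v d x m + FG v e x m := by
  induction m with
  | zero => omega
  | succ m ih =>
    simp only [FG]
    by_cases hkm : k = m
    · subst hkm
      rw [FG_congr (v := v) (w := v) (c := d) (d := c) x k (fun _ _ => rfl)
          (fun i hi => hcd i (by omega) (by omega)),
        FG_congr (v := v) (w := v) (c := e) (d := c) x k (fun _ _ => rfl)
          (fun i hi => hce i (by omega) (by omega)), hc, hd, he]
      simp only [facG]
      rw [add_mul, add_comm]
    · rw [hcd m (by omega) (by omega), hce m (by omega) (by omega),
        ih (by omega) (fun i hi => hcd i (by omega)) (fun i hi => hce i (by omega)), mul_add]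

/-- Linear type A zero-Hecke relations on the sites `0, …, m - 1`. -/
structure LinRel (v : ℕ → R) (m : ℕ) : Prop where
  sq : ∀ i < m, v i * v i = v i
  braid : ∀ i, i + 1 < m → v i * v (i + 1) * v i = v (i + 1) * v i * v (i + 1)
  comm : ∀ i j, i + 2 ≤ j → j < m → Commute (v i) (v j)

theorem LinRel.mono {R : Type*} [Ring R] {v : ℕ → R} {m k : ℕ} (h : LinRel v m) (hk : k ≤ m) : LinRel v k :=
  ⟨fun i hi => h.sq i (by omega), fun i hi => h.braid i (by omega),
    fun i j hi hj => h.comm i j hi (by omega)⟩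

theorem LinRel.shift {R : Type*} [Ring R] {v : ℕ → R} {m : ℕ} (a k : ℕ) (h : LinRel v m) (hk : a + k ≤ m) :
    LinRel (fun j => v (a + j)) k :=
  ⟨fun i hi => h.sq _ (by omega), fun i hi => h.braid (a + i) (by omega),
    fun i j hi hj => h.comm _ _ (by omega) (by omega)⟩

theorem ybe_aux (a b : R) (ha : a * a = a) (hb : b * b = b) (hab : a * b * a = b * a * b)
    (x y : ℂ) :
    (1 + x • b) * (1 + x • a) * (1 + y • b) * ((1 + x) • (1 : R) - x • a) =
      (1 + x) • (1 + (x + y + x * y) • b + (x * y) • (a * b - b * a)) := by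
  have h1 : b * a * a = b * a := by rw [mul_assoc, ha]
  have h2 : b * a * b * a = b * a * b := by rw [← hab, mul_assoc, ha]
  simp only [mul_add, add_mul, mul_sub, one_mul, mul_one, smul_mul_assoc, mul_smul_comm,
    smul_add, smul_sub, smul_smul, ha, hb, h1, h2, hab]
  module

theorem free_commute (v : ℕ → R) (m : ℕ) (h : LinRel v m) (x y : ℂ) (hx : 1 + x ≠ 0)
    (hy : 1 + y ≠ 0) :
    FG v (fun _ => none) x m * FG v (fun _ => none) y m =
      FG v (fun _ => none) y m * FG v (fun _ => none) x m := by
  induction m with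
  | zero => simp [FG]
  | succ m ih =>
    have ih := ih (h.mono (by omega))
    rcases m with _ | m
    · simp only [FG, mul_one]
      exact facG_commute (Or.inl (Commute.refl _))
    · have key : ∀ x y : ℂ, 1 + x ≠ 0 → FG v (fun _ => none) x (m + 2) *
          FG v (fun _ => none) y (m + 2) =
          (1 + (x + y + x * y) • v (m + 1) + (x * y) • (v m * v (m + 1) - v (m + 1) * v m)) *
          (FG v (fun _ => none) x (m + 1) * FG v (fun _ => none) y (m + 1)) := by
        intro x y hx
        have hc : Commute (FG v (fun _ => none) x m) (1 + y • v (m + 1)) := by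
          have := FG_commute (v := v) (w := fun _ => v (m + 1)) (c := fun _ => none)
            (d := fun _ => none) (x := x) (y := y) (a := m) (b := 1)
            (fun i hi j hj => Or.inl (h.comm _ _ (by omega) (by omega)))
          simpa [FG, facG] using this
        have hI : ((1 + x) • (1 : R) - x • v m) * (1 + x • v m) = (1 + x) • (1 : R) := by
          simp only [mul_add, sub_mul, one_mul, mul_one, smul_mul_assoc, mul_smul_comm,
            smul_sub, smul_smul, h.sq m (by omega)]
          module
        have hY := ybe_aux (v m) (v (m + 1)) (h.sq _ (by omega)) (h.sq _ (by omega))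
          (h.braid _ (by omega)) x y
        have e1 : FG v (fun _ => none) x (m + 2) * FG v (fun _ => none) y (m + 2) =
            (1 + x • v (m + 1)) * (1 + x • v m) * (1 + y • v (m + 1)) *
            (FG v (fun _ => none) x m * FG v (fun _ => none) y (m + 1)) := by
          have : FG v (fun _ => none) x (m + 2) * FG v (fun _ => none) y (m + 2) =
            (1 + x • v (m + 1)) * (1 + x • v m) * (FG v (fun _ => none) x m *
              (1 + y • v (m + 1))) * FG v (fun _ => none) y (m + 1) := by
            simp only [FG, facG, mul_assoc]
          rw [this, hc.eq]
          simp only [mul_assoc]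
        have e2 : (1 + x) • (FG v (fun _ => none) x m * FG v (fun _ => none) y (m + 1)) =
            ((1 + x) • (1 : R) - x • v m) *
            (FG v (fun _ => none) x (m + 1) * FG v (fun _ => none) y (m + 1)) := by
          have : FG v (fun _ => none) x (m + 1) = (1 + x • v m) * FG v (fun _ => none) x m := rfl
          rw [this, mul_assoc, ← mul_assoc, hI, smul_mul_assoc, one_mul]
        have e3 : (1 + x) • (FG v (fun _ => none) x (m + 2) * FG v (fun _ => none) y (m + 2)) =
            (1 + x) • ((1 + (x + y + x * y) • v (m + 1) +
              (x * y) • (v m * v (m + 1) - v (m + 1) * v m)) *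
          (FG v (fun _ => none) x (m + 1) * FG v (fun _ => none) y (m + 1))) := by
          rw [e1, ← mul_smul_comm, e2, ← mul_assoc, hY, smul_mul_assoc]
        have := congrArg (fun z => (1 + x)⁻¹ • z) e3
        simpa only [smul_smul, inv_mul_cancel₀ hx, one_smul] using this
      rw [key x y hx, key y x hy, ih, mul_comm y x, add_comm y x]

/-- A zero segment `[p, q]`. -/
structure SegG (c d : ℕ → Option Bool) (p q : ℕ) : Prop where
  ct : ∀ i, p ≤ i → i < q → c i = some true
  cf : c q = some false
  df : d p = some false
  dt : ∀ i, p < i → i ≤ q → d i = some true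

theorem lin_sym (v : ℕ → R) (x y : ℂ) (hx : 1 + x ≠ 0) (hy : 1 + y ≠ 0)
    (c d : ℕ → Option Bool) (m : ℕ) (h : LinRel v m)
    (H : ∀ i < m, (c i = none ∧ d i = none) ∨ ∃ p q, p ≤ i ∧ i ≤ q ∧ q < m ∧ SegG c d p q) :
    FG v c x m * FG v d y m = FG v c y m * FG v d x m := by
  induction m using Nat.strong_induction_on with
  | _ m ih =>
  by_cases hf : ∀ i < m, c i = none ∧ d i = none
  · have e1 : ∀ z, FG v c z m = FG v (fun _ => none) z m := fun z =>
      FG_congr z m (fun _ _ => rfl) (fun i hi => (hf i hi).1)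
    have e2 : ∀ z, FG v d z m = FG v (fun _ => none) z m := fun z =>
      FG_congr z m (fun _ _ => rfl) (fun i hi => (hf i hi).2)
    rw [e1, e1, e2, e2]
    exact free_commute v m h x y hx hy
  · have hex : ∃ r, ∃ i, i < m ∧ m = i + 1 + r ∧ ¬ (c i = none ∧ d i = none) := by
      push Not at hf
      obtain ⟨i, hi, hi'⟩ := hf
      exact ⟨m - i - 1, i, hi, by omega, fun hh => hi' hh.1 hh.2⟩
    classical
    obtain ⟨i, him, hmi, hni⟩ := Nat.find_spec hex
    set r := Nat.find hex with hr
    have hmin : ∀ j < m, i < j → c j = none ∧ d j = none := by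
      intro j hj hij
      by_contra hcon
      exact Nat.find_min hex (m := m - j - 1) (by omega) ⟨j, hj, by omega, hcon⟩
    obtain ⟨p, q, hpi, hiq, hqm, hs⟩ := (H i him).resolve_left hni
    have hqi : q = i := by
      by_contra hne
      have := (hmin q hqm (by omega)).1
      rw [hs.cf] at this
      cases this
    subst hqi
    obtain ⟨k, rfl⟩ := Nat.exists_eq_add_of_le hpi
    have hlow := ih p (by omega) (h.mono (by omega)) (by
      intro j hj
      rcases H j (by omega) with hn | ⟨p', q', h1, h2, h3, h4⟩
      · exact Or.inl hn
      · refine Or.inr ⟨p', q', h1, h2, ?_, h4⟩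
        by_contra hcon
        have := h4.dt p (by omega) (by omega)
        rw [hs.df] at this
        simp at this)
    have dec : ∀ (c : ℕ → Option Bool) (z : ℂ), FG v c z m =
        FG (fun j => v (p + (k + 1) + j)) (fun j => c (p + (k + 1) + j)) z r *
        (FG (fun j => v (p + j)) (fun j => c (p + j)) z (k + 1) * FG v c z p) := by
      intro c z
      rw [← FG_split v c z p (k + 1), ← FG_split v c z (p + (k + 1)) r]
      congr 1
    have com : ∀ x y : ℂ, FG v c x m * FG v d y m =
        (FG (fun j => v (p + (k + 1) + j)) (fun j => c (p + (k + 1) + j)) x r *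
          FG (fun j => v (p + (k + 1) + j)) (fun j => d (p + (k + 1) + j)) y r) *
        (FG (fun j => v (p + j)) (fun j => c (p + j)) x (k + 1) *
          FG (fun j => v (p + j)) (fun j => d (p + j)) y (k + 1)) *
        (FG v c x p * FG v d y p) := by
      intro x y
      rw [dec c x, dec d y]
      have c1 : Commute (FG v c x p)
          (FG (fun j => v (p + (k + 1) + j)) (fun j => d (p + (k + 1) + j)) y r) :=
        FG_commute fun i hi j hj => Or.inl (h.comm _ _ (by omega) (by omega))
      have c2 : Commute (FG v c x p)
          (FG (fun j => v (p + j)) (fun j => d (p + j)) y (k + 1)) :=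
        FG_commute fun i hi j hj => by
          rcases j with _ | j
          · exact Or.inr (Or.inr hs.df)
          · exact Or.inl (h.comm _ _ (by omega) (by omega))
      have c3 : Commute (FG (fun j => v (p + j)) (fun j => c (p + j)) x (k + 1))
          (FG (fun j => v (p + (k + 1) + j)) (fun j => d (p + (k + 1) + j)) y r) :=
        FG_commute fun i hi j hj => by
          by_cases hik : i = k
          · subst hik
            exact Or.inr (Or.inl hs.cf)
          · exact Or.inl (h.comm _ _ (by omega) (by omega))
      generalize FG (fun j => v (p + (k + 1) + j)) (fun j => c (p + (k + 1) + j)) x r = U at *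
      generalize FG (fun j => v (p + (k + 1) + j)) (fun j => d (p + (k + 1) + j)) y r = U' at *
      generalize FG (fun j => v (p + j)) (fun j => c (p + j)) x (k + 1) = G at *
      generalize FG (fun j => v (p + j)) (fun j => d (p + j)) y (k + 1) = G' at *
      generalize FG v c x p = L at *
      generalize FG v d y p = L' at *
      calc U * (G * L) * (U' * (G' * L')) = U * G * (L * U') * G' * L' := by
            simp only [mul_assoc]
        _ = U * (G * U') * (L * G') * L' := by rw [c1.eq]; simp only [mul_assoc]
        _ = _ := by rw [c2.eq, c3.eq]; simp only [mul_assoc]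
    rw [com x y, com y x, hlow]
    congr 2
    · have e1 : ∀ z, FG (fun j => v (p + (k + 1) + j)) (fun j => c (p + (k + 1) + j)) z r =
          FG (fun j => v (p + (k + 1) + j)) (fun _ => none) z r := fun z =>
        FG_congr z r (fun _ _ => rfl) (fun i hi => (hmin _ (by omega) (by omega)).1)
      have e2 : ∀ z, FG (fun j => v (p + (k + 1) + j)) (fun j => d (p + (k + 1) + j)) z r =
          FG (fun j => v (p + (k + 1) + j)) (fun _ => none) z r := fun z =>
        FG_congr z r (fun _ _ => rfl) (fun i hi => (hmin _ (by omega) (by omega)).2)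
      rw [e1, e1, e2, e2]
      exact free_commute _ r (h.shift _ _ (by omega)) x y hx hy
    · have e1 : ∀ z, FG (fun j => v (p + j)) (fun j => c (p + j)) z (k + 1) =
          z ^ k • FG (fun j => v (p + j)) (fun j => c (p + j)) 1 (k + 1) := fun z =>
        FG_true_false _ _ _ _ hs.cf (fun i hi => hs.ct _ (by omega) (by omega))
      have e2 : ∀ z, FG (fun j => v (p + j)) (fun j => d (p + j)) z (k + 1) =
          z ^ k • FG (fun j => v (p + j)) (fun j => d (p + j)) 1 (k + 1) := fun z => by
        rw [add_comm k 1]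
        exact FG_false_true _ _ _ _ hs.df (fun i hi => hs.dt _ (by omega) (by omega))
      rw [e1 x, e1 y, e2 x, e2 y, smul_mul_smul_comm, smul_mul_smul_comm, mul_comm (x ^ k)]

/-- Coefficient extraction. -/
theorem coeff_extract {V : Type*} [AddCommGroup V] [Module ℂ V] (N : ℕ) (a : ℕ → V)
    (h : ∀ x : ℂ, 1 + x ≠ 0 → ∑ k ∈ Finset.range N, x ^ k • a k = 0) :
    ∀ k < N, a k = 0 := by
  intro k hk
  rw [← Module.forall_dual_apply_eq_zero_iff ℂ]
  intro φ
  let P : Polynomial ℂ := ∑ k ∈ Finset.range N, Polynomial.C (φ (a k)) * Polynomial.X ^ k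
  have hP : P = 0 := by
    refine Polynomial.eq_zero_of_infinite_isRoot P ?_
    refine Set.Infinite.mono (s := {x : ℂ | x ≠ -1}) ?_ ?_
    · intro x hx
      have hx' : 1 + x ≠ 0 := fun hh => hx (by linear_combination hh)
      have := congrArg φ (h x hx')
      simp only [map_sum, map_smul, map_zero, smul_eq_mul] at this
      simp only [P, Set.mem_ofPred_eq, Polynomial.IsRoot, Polynomial.eval_finsetSum,
        Polynomial.eval_mul, Polynomial.eval_C, Polynomial.eval_pow, Polynomial.eval_X]
      rw [← this]
      exact Finset.sum_congr rfl fun i _ => mul_comm _ _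
    · exact (Set.finite_singleton (-1 : ℂ)).infinite_compl
  have := congrArg (fun Q => Polynomial.coeff Q k) hP
  simpa [P, Polynomial.finsetSum_coeff, Polynomial.coeff_C_mul, Polynomial.coeff_X_pow, hk]
    using this
end Lin
section Cyc

theorem uGT_sq (n : ℕ) (i : ZMod n) : uGT n i * uGT n i = uGT n i := by
  have := RingQuot.mkAlgHom_rel ℂ (GrothRel.sq i)
  simpa [uGT] using this

theorem uGT_braid (n : ℕ) (i : ZMod n) :
    uGT n i * uGT n (i + 1) * uGT n i = uGT n (i + 1) * uGT n i * uGT n (i + 1) := by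
  have := RingQuot.mkAlgHom_rel ℂ (GrothRel.braid i)
  simpa [uGT] using this

theorem uGT_comm (n : ℕ) (i j : ZMod n) (h1 : i - j ≠ 1) (h2 : j - i ≠ 1) :
    Commute (uGT n i) (uGT n j) := by
  have := RingQuot.mkAlgHom_rel ℂ (GrothRel.comm i j h1 h2)
  simpa [uGT, Commute, SemiconjBy] using this

theorem natCast_ne_zero_of_lt {n d : ℕ} (h0 : 0 < d) (h : d < n) : ((d : ℕ) : ZMod n) ≠ 0 := by
  rw [Ne, ZMod.natCast_eq_zero_iff]
  exact Nat.not_dvd_of_pos_of_lt h0 h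

theorem natCast_inj_of_lt {n a b : ℕ} (ha : a < n) (hb : b < n)
    (h : ((a : ℕ) : ZMod n) = (b : ℕ)) : a = b := by
  rw [ZMod.natCast_eq_natCast_iff'] at h
  rwa [Nat.mod_eq_of_lt ha, Nat.mod_eq_of_lt hb] at h

theorem uGT_comm_nat (n : ℕ) (s : ZMod n) (i j : ℕ) (h : i + 2 ≤ j) (h' : j < i + (n - 1)) :
    Commute (uGT n (s + (i : ℕ))) (uGT n (s + (j : ℕ))) := by
  obtain ⟨d, rfl⟩ := Nat.exists_eq_add_of_le h
  apply uGT_comm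
  · intro hh
    refine natCast_ne_zero_of_lt (n := n) (d := d + 3) (by omega) (by omega) ?_
    push_cast at hh ⊢
    linear_combination -hh
  · intro hh
    refine natCast_ne_zero_of_lt (n := n) (d := d + 1) (by omega) (by omega) ?_
    push_cast at hh ⊢
    linear_combination hh

theorem linRel_uGT (n : ℕ) (s : ZMod n) (m : ℕ) (hm : m ≤ n - 1) :
    LinRel (fun j => uGT n (s + (j : ℕ))) m where
  sq i _ := uGT_sq n _
  braid i _ := by
    have := uGT_braid n (s + (i : ℕ))
    simpa [add_assoc] using this
  comm i j hi hj := uGT_comm_nat n s i j hi (by omega)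

/-- Cyclic product started at `e`. -/
noncomputable def WG (n : ℕ) (c : ZMod n → Option Bool) (x : ℂ) (e : ZMod n) : Groth n :=
  FG (fun j => uGT n (e + (j : ℕ))) (fun j => c (e + (j : ℕ))) x n

theorem WG_indep (n : ℕ) [NeZero n] (c : ZMod n → Option Bool) (x : ℂ) (e e' : ZMod n)
    (he : c e = some false) (he' : c e' = some false) : WG n c x e = WG n c x e' := by
  obtain ⟨k, hk, rfl⟩ : ∃ k : ℕ, k < n ∧ e' = e + (k : ℕ) :=
    ⟨(e' - e).val, ZMod.val_lt _, by simp⟩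
  obtain ⟨r, hr⟩ := Nat.exists_eq_add_of_le hk.le
  have h1 : WG n c x e =
      FG (fun j => uGT n (e + (k : ℕ) + (j : ℕ))) (fun j => c (e + (k : ℕ) + (j : ℕ))) x r *
      FG (fun j => uGT n (e + (j : ℕ))) (fun j => c (e + (j : ℕ))) x k := by
    unfold WG
    conv_lhs => rw [show FG (fun j => uGT n (e + (j : ℕ))) (fun j => c (e + (j : ℕ))) x n =
      FG (fun j => uGT n (e + (j : ℕ))) (fun j => c (e + (j : ℕ))) x (k + r) from by rw [← hr]]
    rw [FG_split]
    congr 1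
    apply FG_congr <;> intros <;> simp [add_assoc]
  have h2 : WG n c x (e + (k : ℕ)) =
      FG (fun j => uGT n (e + (j : ℕ))) (fun j => c (e + (j : ℕ))) x k *
      FG (fun j => uGT n (e + (k : ℕ) + (j : ℕ))) (fun j => c (e + (k : ℕ) + (j : ℕ))) x r := by
    unfold WG
    conv_lhs => rw [show FG (fun j => uGT n (e + (k : ℕ) + (j : ℕ)))
      (fun j => c (e + (k : ℕ) + (j : ℕ))) x n =
      FG (fun j => uGT n (e + (k : ℕ) + (j : ℕ)))
      (fun j => c (e + (k : ℕ) + (j : ℕ))) x (r + k) from by rw [add_comm r k, ← hr]]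
    rw [FG_split]
    have hz : ((k : ℕ) : ZMod n) + (r : ℕ) = 0 := by
      rw [← Nat.cast_add, ← hr, ZMod.natCast_self]
    have hs : ∀ i : ℕ, e + (k : ℕ) + ((r + i : ℕ) : ZMod n) = e + (i : ℕ) := by
      intro i
      push_cast
      linear_combination hz
    congr 1
    apply FG_congr <;> intro i _ <;> simp only [hs]
  rw [h1, h2]
  refine (FG_commute ?_).symm.eq
  intro i hi j hj
  by_cases ha : i + 2 ≤ k + j
  · by_cases hb : k + j < i + (n - 1)
    · left
      have := uGT_comm_nat n e i (k + j) ha hb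
      simpa [add_assoc] using this
    · have : i = 0 := by omega
      subst this
      right; left; simpa using he
  · have : j = 0 := by omega
    subst this
    right; right; simpa using he'

theorem FG_list (n : ℕ) (A : Finset (ZMod n)) (e : ZMod n) (x : ℂ) (m : ℕ) :
    FG (fun j => uGT n (e + (j : ℕ))) (fun j => some (decide (e + (j : ℕ) ∈ A))) x m =
    x ^ (((List.range m).reverse.map (fun j : ℕ => e + (j : ZMod n))).filter (· ∈ A)).length •
    ((((List.range m).reverse.map (fun j : ℕ => e + (j : ZMod n))).filter (· ∈ A)).map
      (uGT n)).prod := by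
  induction m with
  | zero => simp [FG]
  | succ m ih =>
    simp only [FG]
    rw [ih, List.range_succ, List.reverse_append]
    by_cases hm : e + (m : ℕ) ∈ A
    · simp [hm, facG, pow_succ, smul_smul]
    · simp [hm, facG]

theorem missT_notMem (n : ℕ) [NeZero n] (A : Finset (ZMod n)) (hA : A ≠ Finset.univ) :
    missT n A ∉ A := by
  unfold missT
  rcases hf : (List.range n).find? fun k : ℕ => decide (((k : ℕ) : ZMod n) ∉ A) with _ | k
  · exfalso
    apply hA
    rw [List.find?_eq_none] at hf
    ext a
    simp only [Finset.mem_univ, iff_true]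
    have := hf a.val (by simpa using ZMod.val_lt a)
    simpa using this
  · have := List.find?_some hf
    simpa using this

theorem uAT_list (n : ℕ) [NeZero n] (A : Finset (ZMod n)) :
    (A.toList.insertionSort fun x y => (y - missT n A).val ≤ (x - missT n A).val) =
    ((List.range n).reverse.map (fun j : ℕ => missT n A + (j : ZMod n))).filter (· ∈ A) := by
  set e := missT n A
  have hnd : ((List.range n).reverse.map (fun j : ℕ => e + (j : ZMod n))).Nodup := by
    refine List.Nodup.map_on ?_ (List.nodup_reverse.2 List.nodup_range)
    intro a ha b hb hab
    simp only [List.mem_reverse, List.mem_range] at ha hb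
    exact natCast_inj_of_lt ha hb (add_left_cancel hab)
  refine List.Perm.eq_of_pairwise (le := fun x y : ZMod n => (y - e).val ≤ (x - e).val) ?_ ?_ ?_ ?_
  · intro a b _ _ h1 h2
    have := ZMod.val_injective n (le_antisymm h2 h1)
    exact sub_left_injective this
  · have : Std.Total (fun x y : ZMod n => (y - e).val ≤ (x - e).val) := ⟨fun a b => le_total _ _⟩
    have : IsTrans (ZMod n) (fun x y : ZMod n => (y - e).val ≤ (x - e).val) :=
      ⟨fun a b c h1 h2 => le_trans h2 h1⟩
    exact List.pairwise_insertionSort _ _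
  · refine List.Pairwise.filter _ ?_
    rw [List.pairwise_map, List.pairwise_reverse]
    have : List.Pairwise (fun a b : ℕ => a < b ∧ b < n) (List.range n) := by
      refine List.Pairwise.imp_of_mem ?_ List.pairwise_lt_range
      intro a b _ hb hab
      exact ⟨hab, List.mem_range.1 hb⟩
    refine this.imp ?_
    intro a b hab
    simp only [add_sub_cancel_left]
    rw [ZMod.val_natCast_of_lt hab.2, ZMod.val_natCast_of_lt (hab.1.trans hab.2)]
    exact hab.1.le
  · refine (List.perm_insertionSort _ _).trans ?_
    rw [List.perm_ext_iff_of_nodup A.nodup_toList (hnd.filter _)]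
    intro a
    simp only [Finset.mem_toList, List.mem_filter, List.mem_map, List.mem_reverse, List.mem_range,
      decide_eq_true_eq]
    refine ⟨fun h => ⟨⟨(a - e).val, ZMod.val_lt _, by simp⟩, h⟩, fun h => h.2⟩

theorem uAT_eq_WG (n : ℕ) [NeZero n] (A : Finset (ZMod n)) (x : ℂ) (e : ZMod n) (he : e ∉ A) :
    x ^ A.card • uAT n A = WG n (fun i => some (decide (i ∈ A))) x e := by
  have hA : A ≠ Finset.univ := fun h => he (h ▸ Finset.mem_univ e)
  rw [WG_indep n _ x e (missT n A) (by simpa using he) (by simpa using missT_notMem n A hA)]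
  unfold WG
  rw [FG_list, ← uAT_list, List.length_insertionSort, Finset.length_toList]
  rfl

/-- Constraint: free on `J`, agreeing with `A` elsewhere. -/
def conG {n : ℕ} (J A : Finset (ZMod n)) (i : ZMod n) : Option Bool :=
  if i ∈ J then none else some (decide (i ∈ A))

theorem sum_conG (n : ℕ) [NeZero n] (x : ℂ) (e : ZMod n) (J : Finset (ZMod n)) (heJ : e ∉ J)
    (A0 : Finset (ZMod n)) (he : e ∉ A0) :
    ∑ A ∈ Finset.univ.filter (fun A : Finset (ZMod n) => ∀ i, i ∉ J → (i ∈ A ↔ i ∈ A0)),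
      x ^ A.card • uAT n A = WG n (conG J A0) x e := by
  induction J using Finset.induction_on generalizing A0 with
  | empty =>
    have : Finset.univ.filter (fun A : Finset (ZMod n) =>
        ∀ i, i ∉ (∅ : Finset (ZMod n)) → (i ∈ A ↔ i ∈ A0)) = {A0} := by
      ext A
      simp [Finset.ext_iff]
    rw [this, Finset.sum_singleton, uAT_eq_WG n A0 x e he]
    rfl
  | insert a J ha ih =>
    have hea : e ≠ a := fun h => heJ (by simp [h])
    have heJ' : e ∉ J := fun h => heJ (by simp [h])
    have h1 := ih heJ' (insert a A0) (by simp [hea, he])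
    have h2 := ih heJ' (A0.erase a) (by simp [he])
    have hW : WG n (conG (insert a J) A0) x e =
        WG n (conG J (insert a A0)) x e + WG n (conG J (A0.erase a)) x e := by
      have hne : ∀ i : ℕ, i < n → i ≠ (a - e).val → e + (i : ZMod n) ≠ a := by
        intro i hi hne hh
        apply hne
        rw [← hh, add_sub_cancel_left, ZMod.val_natCast_of_lt hi]
      refine FG_add _ _ _ _ x n (a - e).val (ZMod.val_lt _) ?_ ?_ ?_ ?_ ?_
      · simp [conG]
      · simp [conG, ha]
      · simp [conG, ha]
      · intro i hi hi'
        simp [conG, hne i hi hi']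
      · intro i hi hi'
        simp [conG, hne i hi hi']
    rw [hW, ← h1, ← h2, ← Finset.sum_union]
    · refine Finset.sum_congr ?_ fun _ _ => rfl
      ext A
      simp only [Finset.mem_filter, Finset.mem_univ, true_and, Finset.mem_union,
        Finset.mem_insert, Finset.mem_erase]
      constructor
      · intro h
        by_cases hA : a ∈ A
        · left
          intro i hi
          by_cases hia : i = a
          · simp [hia, hA]
          · simpa [hia] using h i (by simp [hia, hi])
        · right
          intro i hi
          by_cases hia : i = a
          · simp [hia, hA]
          · simpa [hia] using h i (by simp [hia, hi])
      · rintro (h | h) i hi <;> push Not at hi <;> simpa [hi.1] using h i hi.2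
    · rw [Finset.disjoint_left]
      intro A hA hA'
      simp only [Finset.mem_filter, Finset.mem_univ, true_and] at hA hA'
      have t1 := hA a ha
      have t2 := hA' a ha
      simp at t1 t2
      exact t2 t1

/-- A cyclic zero segment. -/
def ZsG {n : ℕ} (A B : Finset (ZMod n)) (p : ZMod n) (l : ℕ) : Prop :=
  p ∉ B ∧ p + (l : ℕ) ∉ A ∧ (∀ i : ℕ, i < l → p + (i : ℕ) ∈ A) ∧
    ∀ i : ℕ, 0 < i → i ≤ l → p + (i : ℕ) ∈ B

theorem exists_ZsG (n : ℕ) [NeZero n] (A B : Finset (ZMod n)) (hA : A ≠ Finset.univ)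
    (hB : B ≠ Finset.univ) : ∃ p : ZMod n, ∃ l < n, ZsG A B p l := by
  classical
  obtain ⟨a, ha⟩ : ∃ a, a ∉ A := by
    by_contra! h; exact hA (Finset.eq_univ_iff_forall.2 h)
  obtain ⟨b, hb⟩ : ∃ b, b ∉ B := by
    by_contra! h; exact hB (Finset.eq_univ_iff_forall.2 h)
  have hex : ∃ l : ℕ, ∃ p : ZMod n, p ∉ B ∧ p + (l : ℕ) ∉ A :=
    ⟨(a - b).val, b, hb, by simpa using ha⟩
  obtain ⟨p, hp, hpl⟩ := Nat.find_spec hex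
  refine ⟨p, Nat.find hex, ?_, hp, hpl, ?_, ?_⟩
  · exact lt_of_le_of_lt (Nat.find_min' hex ⟨b, hb, by simpa using ha⟩) (ZMod.val_lt (a - b))
  · intro i hi
    by_contra hcon
    exact Nat.find_min hex hi ⟨p, hp, hcon⟩
  · intro i hi hil
    by_contra hcon
    refine Nat.find_min hex (m := Nat.find hex - i) (by omega) ⟨p + (i : ℕ), hcon, ?_⟩
    rw [add_assoc, ← Nat.cast_add, Nat.add_sub_cancel' hil]
    exact hpl

end Cyc
section Main

/-- The key identity for a fixed nonempty family of prescribed zero segments. -/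
theorem fam_sym (n : ℕ) [NeZero n] (x y : ℂ) (hx : 1 + x ≠ 0) (hy : 1 + y ≠ 0)
    (T : Set (ZMod n × ℕ)) (hT : ∀ t ∈ T, t.2 < n) (A0 B0 : Finset (ZMod n))
    (h0 : ∀ t ∈ T, ZsG A0 B0 t.1 t.2) (t0 : ZMod n × ℕ) (ht0 : t0 ∈ T) (J : Finset (ZMod n))
    (hJ : ∀ i, i ∉ J ↔ ∃ t ∈ T, ∃ j : ℕ, j ≤ t.2 ∧ i = t.1 + (j : ℕ)) :
    WG n (conG J A0) x (t0.1 + (t0.2 : ℕ)) * WG n (conG J B0) y t0.1 =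
    WG n (conG J A0) y (t0.1 + (t0.2 : ℕ)) * WG n (conG J B0) x t0.1 := by
  obtain ⟨p0, l⟩ := t0
  simp only
  have hl : l < n := hT _ ht0
  obtain ⟨z1, z2, z3, z4⟩ := h0 _ ht0
  simp only at z1 z2 z3 z4
  obtain ⟨m, hm⟩ := Nat.exists_eq_add_of_lt hl
  have hz : ((l : ℕ) : ZMod n) + (m : ℕ) + 1 = 0 := by
    have : ((l + m + 1 : ℕ) : ZMod n) = 0 := by rw [← hm, ZMod.natCast_self]
    simpa using this
  have inJ : ∀ j : ℕ, j ≤ l → p0 + (j : ℕ) ∉ J := fun j hj => (hJ _).2 ⟨_, ht0, j, hj, rfl⟩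
  -- decomposition of the A-factor
  have dA : ∀ z : ℂ, WG n (conG J A0) z (p0 + (l : ℕ)) =
      z ^ l • (FG (fun j => uGT n (p0 + (j : ℕ))) (fun j => conG J A0 (p0 + (j : ℕ))) 1 l *
        FG (fun j => uGT n (p0 + (l : ℕ) + 1 + (j : ℕ)))
          (fun j => conG J A0 (p0 + (l : ℕ) + 1 + (j : ℕ))) z m) := by
    intro z
    have e0 : WG n (conG J A0) z (p0 + (l : ℕ)) =
      FG (fun j => uGT n (p0 + (l : ℕ) + (j : ℕ)))
        (fun j => conG J A0 (p0 + (l : ℕ) + (j : ℕ))) z (1 + m + l) := by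
      unfold WG
      congr 1
      omega
    rw [e0, FG_split, FG_split, FG_false_one, mul_one, ← smul_mul_assoc, ← FG_true]
    · congr 1
      · have hs : ∀ i : ℕ, p0 + (l : ℕ) + ((1 + m + i : ℕ) : ZMod n) = p0 + (i : ℕ) := by
          intro i
          push_cast
          linear_combination hz
        apply FG_congr <;> intro i _ <;> simp only [hs]
      · apply FG_congr <;> intro i _ <;> simp [add_assoc]
    · intro i hi
      simp [conG, inJ i hi.le, z3 i hi]
    · simp [conG, inJ l le_rfl, z2]
  have dB : ∀ z : ℂ, WG n (conG J B0) z p0 =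
      z ^ l • (FG (fun j => uGT n (p0 + (l : ℕ) + 1 + (j : ℕ)))
          (fun j => conG J B0 (p0 + (l : ℕ) + 1 + (j : ℕ))) z m *
        FG (fun j => uGT n (p0 + (j : ℕ))) (fun j => conG J B0 (p0 + (j : ℕ))) 1 (1 + l)) := by
    intro z
    have e0 : WG n (conG J B0) z p0 =
      FG (fun j => uGT n (p0 + (j : ℕ)))
        (fun j => conG J B0 (p0 + (j : ℕ))) z (1 + l + m) := by
      unfold WG
      congr 1
      omega
    rw [e0, FG_split, ← mul_smul_comm, ← FG_false_true]
    · congr 1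
      have hs : ∀ i : ℕ, p0 + ((1 + l + i : ℕ) : ZMod n) = p0 + (l : ℕ) + 1 + (i : ℕ) := by
        intro i
        push_cast
        ring
      apply FG_congr <;> intro i _ <;> simp only [hs]
    · have := inJ 0 (by omega)
      simp only [Nat.cast_zero, add_zero] at this
      simp [conG, this, z1]
    · intro i hi
      have h1 := inJ (1 + i) (by omega)
      have h2 := z4 (1 + i) (by omega) (by omega)
      simp only [conG, h1, h2, if_false, decide_true]
  have key : FG (fun j => uGT n (p0 + (l : ℕ) + 1 + (j : ℕ)))
          (fun j => conG J A0 (p0 + (l : ℕ) + 1 + (j : ℕ))) x m *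
        FG (fun j => uGT n (p0 + (l : ℕ) + 1 + (j : ℕ)))
          (fun j => conG J B0 (p0 + (l : ℕ) + 1 + (j : ℕ))) y m =
      FG (fun j => uGT n (p0 + (l : ℕ) + 1 + (j : ℕ)))
          (fun j => conG J A0 (p0 + (l : ℕ) + 1 + (j : ℕ))) y m *
        FG (fun j => uGT n (p0 + (l : ℕ) + 1 + (j : ℕ)))
          (fun j => conG J B0 (p0 + (l : ℕ) + 1 + (j : ℕ))) x m := by
    refine lin_sym _ x y hx hy _ _ m (linRel_uGT n _ m (by omega)) ?_
    intro j hj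
    by_cases hjJ : p0 + (l : ℕ) + 1 + (j : ℕ) ∈ J
    · left
      simp [conG, hjJ]
    right
    obtain ⟨⟨p', l'⟩, ht', i, hi, hpi⟩ := (hJ _).1 hjJ
    simp only at hi hpi
    have hl' : l' < n := hT _ ht'
    obtain ⟨w1, w2, w3, w4⟩ := h0 _ ht'
    simp only at w1 w2 w3 w4
    obtain ⟨a, ha, rfl⟩ : ∃ a : ℕ, a < n ∧ p' = p0 + (a : ℕ) :=
      ⟨(p' - p0).val, ZMod.val_lt _, by simp⟩
    have e1 : ((l + 1 + j : ℕ) : ZMod n) = ((a + i : ℕ) : ZMod n) := by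
      push_cast
      linear_combination hpi
    have a1 : a + l' < n := by
      by_contra hcon
      rcases Nat.eq_zero_or_pos a with h | h
      · omega
      · apply z1
        have := w4 (n - a) (by omega) (by omega)
        rwa [add_assoc, ← Nat.cast_add, Nat.add_sub_cancel' ha.le, ZMod.natCast_self,
          add_zero] at this
    have e2 : l + 1 + j = a + i := natCast_inj_of_lt (by omega) (by omega) e1
    have a2 : l < a := by
      by_contra hcon
      rcases Nat.eq_zero_or_pos a with h | h
      · subst h
        simp only [Nat.cast_zero, add_zero] at w1 w2 w3 w4
        exact z2 (w3 l (by omega))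
      · exact w1 (z4 a h (by omega))
    have site : ∀ r : ℕ, a ≤ l + 1 + r → p0 + (l : ℕ) + 1 + (r : ZMod n) =
        p0 + (a : ℕ) + ((l + 1 + r - a : ℕ) : ZMod n) := by
      intro r hr
      rw [Nat.cast_sub hr]
      push_cast
      ring
    have inJ' : ∀ j : ℕ, j ≤ l' → p0 + (a : ℕ) + (j : ℕ) ∉ J :=
      fun j hj => (hJ _).2 ⟨_, ht', j, hj, rfl⟩
    refine ⟨a - l - 1, a - l - 1 + l', by omega, by omega, by omega, ?_, ?_, ?_, ?_⟩
    · intro r hr hr'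
      rw [site r (by omega)]
      simp only [conG, inJ' _ (show l + 1 + r - a ≤ l' by omega),
        w3 _ (show l + 1 + r - a < l' by omega), if_false, decide_true]
    · rw [site _ (by omega), show l + 1 + (a - l - 1 + l') - a = l' by omega]
      simp only [conG, inJ' l' le_rfl, w2, if_false, decide_false]
    · rw [site _ (by omega), show l + 1 + (a - l - 1) - a = 0 by omega]
      have := inJ' 0 (by omega)
      simp only [Nat.cast_zero, add_zero] at this ⊢
      simp only [conG, this, w1, if_false, decide_false]
    · intro r hr hr'
      rw [site r (by omega)]
      simp only [conG, inJ' _ (show l + 1 + r - a ≤ l' by omega),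
        w4 _ (show 0 < l + 1 + r - a by omega) (show l + 1 + r - a ≤ l' by omega),
        if_false, decide_true]
  rw [dA, dB, dA, dB, smul_mul_smul_comm, smul_mul_smul_comm, mul_comm (x ^ l)]
  congr 1
  rw [mul_assoc, mul_assoc, ← mul_assoc (FG _ _ x m), key, mul_assoc]

/-- Weighted term attached to a pair. -/
noncomputable def wG (n : ℕ) (x y : ℂ) (P : Finset (ZMod n) × Finset (ZMod n)) : Groth n :=
  (x ^ P.1.card • uAT n P.1) * (y ^ P.2.card • uAT n P.2)

theorem pair_sym (n : ℕ) [NeZero n] (x y : ℂ) (hx : 1 + x ≠ 0) (hy : 1 + y ≠ 0)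
    (T : Finset (ZMod n × Fin n)) (hne : T.Nonempty)
    (Q : Finset (Finset (ZMod n) × Finset (ZMod n)))
    (hQ : ∀ P, P ∈ Q ↔ ∀ t ∈ T, ZsG P.1 P.2 t.1 (t.2 : ℕ)) :
    ∑ P ∈ Q, wG n x y P = ∑ P ∈ Q, wG n y x P := by
  classical
  rcases Q.eq_empty_or_nonempty with rfl | ⟨⟨A0, B0⟩, hP0⟩
  · simp
  have h0 := (hQ _).1 hP0
  simp only at h0
  obtain ⟨t0, ht0⟩ := hne
  let T' : Set (ZMod n × ℕ) := {s | ∃ t ∈ T, s = (t.1, (t.2 : ℕ))}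
  let J : Finset (ZMod n) := Finset.univ.filter fun i =>
    ¬ ∃ t ∈ T', ∃ j : ℕ, j ≤ t.2 ∧ i = t.1 + (j : ℕ)
  have hJ : ∀ i, i ∉ J ↔ ∃ t ∈ T', ∃ j : ℕ, j ≤ t.2 ∧ i = t.1 + (j : ℕ) := by
    intro i
    simp only [J, Finset.mem_filter, Finset.mem_univ, true_and, not_not]
  have hmem : ∀ t ∈ T, ∀ j : ℕ, j ≤ (t.2 : ℕ) → t.1 + (j : ℕ) ∉ J := fun t ht j hj =>
    (hJ _).2 ⟨(t.1, (t.2 : ℕ)), ⟨t, ht, rfl⟩, j, hj, rfl⟩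
  have hQe : Q = (Finset.univ.filter (fun A : Finset (ZMod n) => ∀ i, i ∉ J → (i ∈ A ↔ i ∈ A0)))
      ×ˢ (Finset.univ.filter (fun A : Finset (ZMod n) => ∀ i, i ∉ J → (i ∈ A ↔ i ∈ B0))) := by
    ext ⟨A, B⟩
    rw [hQ, Finset.mem_product]
    simp only [Finset.mem_filter, Finset.mem_univ, true_and]
    constructor
    · intro h
      constructor
      · intro i hi
        obtain ⟨_, ⟨t, ht, rfl⟩, j, hj, rfl⟩ := (hJ i).1 hi
        simp only at hj ⊢
        rcases hj.lt_or_eq with hlt | rfl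
        · simp only [(h t ht).2.2.1 j hlt, (h0 t ht).2.2.1 j hlt]
        · simp only [(h t ht).2.1, (h0 t ht).2.1]
      · intro i hi
        obtain ⟨_, ⟨t, ht, rfl⟩, j, hj, rfl⟩ := (hJ i).1 hi
        simp only at hj ⊢
        rcases Nat.eq_zero_or_pos j with rfl | hpos
        · simp only [Nat.cast_zero, add_zero, (h t ht).1, (h0 t ht).1]
        · simp only [(h t ht).2.2.2 j hpos hj, (h0 t ht).2.2.2 j hpos hj]
    · rintro ⟨hA, hB⟩ t ht
      obtain ⟨w1, w2, w3, w4⟩ := h0 t ht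
      refine ⟨?_, ?_, ?_, ?_⟩
      · have := hmem t ht 0 (by omega)
        rw [Nat.cast_zero, add_zero] at this
        rwa [hB _ this]
      · rwa [hA _ (hmem t ht _ le_rfl)]
      · intro i hi
        rw [hA _ (hmem t ht _ hi.le)]
        exact w3 i hi
      · intro i hi hi'
        rw [hB _ (hmem t ht _ hi')]
        exact w4 i hi hi'
  have hsum : ∀ x y : ℂ, ∑ P ∈ Q, wG n x y P =
      WG n (conG J A0) x (t0.1 + ((t0.2 : ℕ) : ZMod n)) * WG n (conG J B0) y t0.1 := by
    intro x y
    have k1 := hmem t0 ht0 0 (by omega)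
    rw [Nat.cast_zero, add_zero] at k1
    rw [← sum_conG n x _ J (hmem t0 ht0 _ le_rfl) A0 (h0 t0 ht0).2.1,
      ← sum_conG n y _ J k1 B0 (h0 t0 ht0).1, Finset.sum_mul_sum, hQe, Finset.sum_product]
    rfl
  rw [hsum, hsum]
  refine fam_sym n x y hx hy T' ?_ A0 B0 ?_ (t0.1, (t0.2 : ℕ)) ⟨t0, ht0, rfl⟩ J hJ
  · rintro _ ⟨t, ht, rfl⟩
    exact t.2.2
  · rintro _ ⟨t, ht, rfl⟩
    exact h0 t ht

theorem proper_sym (n : ℕ) [NeZero n] (x y : ℂ) (hx : 1 + x ≠ 0) (hy : 1 + y ≠ 0)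
    (Q : Finset (Finset (ZMod n) × Finset (ZMod n)))
    (hQ : ∀ P, P ∈ Q ↔ P.1 ≠ Finset.univ ∧ P.2 ≠ Finset.univ) :
    ∑ P ∈ Q, wG n x y P = ∑ P ∈ Q, wG n y x P := by
  classical
  let S : ZMod n × Fin n → Finset (Finset (ZMod n) × Finset (ZMod n)) := fun t =>
    Finset.univ.filter fun P => ZsG P.1 P.2 t.1 (t.2 : ℕ)
  have hQe : Q = (Finset.univ : Finset (ZMod n × Fin n)).biUnion S := by
    ext P
    rw [hQ]
    simp only [S, Finset.mem_biUnion, Finset.mem_univ, true_and, Finset.mem_filter]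
    constructor
    · rintro ⟨h1, h2⟩
      obtain ⟨p, l, hl, h⟩ := exists_ZsG n P.1 P.2 h1 h2
      exact ⟨(p, ⟨l, hl⟩), h⟩
    · rintro ⟨t, ht⟩
      exact ⟨fun h => ht.2.1 (h ▸ Finset.mem_univ _), fun h => ht.1 (h ▸ Finset.mem_univ _)⟩
  rw [hQe, Finset.inclusion_exclusion_sum_biUnion, Finset.inclusion_exclusion_sum_biUnion]
  refine Finset.sum_congr rfl fun T _ => ?_
  congr 1
  have hne := (Finset.mem_filter.1 T.2).2
  refine pair_sym n x y hx hy T.1 hne _ ?_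
  intro P
  rw [Finset.mem_inf']
  simp only [S, Finset.mem_filter, Finset.mem_univ, true_and]

theorem gen_hT (n : ℕ) [NeZero n] (x : ℂ) :
    ∑ k ∈ Finset.range n, x ^ k • hT n k =
      ∑ A ∈ Finset.univ.filter (fun A : Finset (ZMod n) => A ≠ Finset.univ),
        x ^ A.card • uAT n A := by
  have himg : (Finset.range n).image (Nat.cast : ℕ → ZMod n) = Finset.univ := by
    ext a
    simp only [Finset.mem_image, Finset.mem_range, Finset.mem_univ, iff_true]
    exact ⟨a.val, ZMod.val_lt a, by simp⟩
  have hmap : ∀ A ∈ Finset.univ.filter (fun A : Finset (ZMod n) => A ≠ Finset.univ),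
      A.card ∈ Finset.range n := by
    intro A hA
    simp only [Finset.mem_filter, Finset.mem_univ, true_and] at hA
    have := Finset.card_lt_univ_of_notMem (s := A) (missT_notMem n A hA)
    simpa [ZMod.card] using this
  rw [← Finset.sum_fiberwise_of_maps_to hmap]
  refine Finset.sum_congr rfl fun k hk => ?_
  rw [hT, himg, Finset.smul_sum]
  refine Finset.sum_congr ?_ ?_
  · ext A
    simp only [Finset.mem_powersetCard, Finset.mem_filter, Finset.mem_univ, true_and,
      Finset.subset_univ]
    constructor
    · intro h
      refine ⟨?_, h⟩
      rintro rfl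
      rw [Finset.card_univ, ZMod.card] at h
      simp only [Finset.mem_range] at hk
      omega
    · exact fun h => h.2
  · intro A hA
    rw [(Finset.mem_filter.1 hA).2]

theorem gen_commute (n : ℕ) [NeZero n] (x y : ℂ) (hx : 1 + x ≠ 0) (hy : 1 + y ≠ 0) :
    (∑ k ∈ Finset.range n, x ^ k • hT n k) * (∑ l ∈ Finset.range n, y ^ l • hT n l) =
    (∑ l ∈ Finset.range n, y ^ l • hT n l) * (∑ k ∈ Finset.range n, x ^ k • hT n k) := by
  rw [gen_hT, gen_hT, Finset.sum_mul_sum, Finset.sum_mul_sum, ← Finset.sum_product',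
    ← Finset.sum_product']
  exact proper_sym n x y hx hy _ (by intro P; simp)

end Main

/-- In the algebra `Ũ_n`, the elements `h̃_0, …, h̃_{n-1}` pairwise commute; consequently
the affine stable Grothendieck polynomials `G̃_w` are symmetric functions. -/
theorem hT_commute (n : ℕ) (hn : 3 ≤ n) (k l : ℕ) (hk : k ≤ n - 1) (hl : l ≤ n - 1) :
    hT n k * hT n l = hT n l * hT n k := by
  have : NeZero n := ⟨by omega⟩
  rw [← sub_eq_zero]
  refine coeff_extract n (fun l => hT n k * hT n l - hT n l * hT n k) ?_ l (by omega)
  intro y hy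
  refine coeff_extract n
    (fun k => ∑ l ∈ Finset.range n, y ^ l • (hT n k * hT n l - hT n l * hT n k)) ?_ k (by omega)
  intro x hx
  have h := sub_eq_zero.2 (gen_commute n x y hx hy)
  rw [Finset.sum_mul_sum, Finset.sum_mul_sum, Finset.sum_comm (s := Finset.range n)
    (f := fun l k => (y ^ l • hT n l) * (x ^ k • hT n k)), ← Finset.sum_sub_distrib] at h
  rw [← h]
  refine Finset.sum_congr rfl fun i _ => ?_
  rw [← Finset.sum_sub_distrib, Finset.smul_sum]
  refine Finset.sum_congr rfl fun j _ => ?_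
  rw [smul_mul_smul_comm, smul_mul_smul_comm, mul_comm (y ^ j), smul_smul]
  exact smul_sub _ _ _
end

section
/- Let a, b be residues mod n with a ≢ b + 1 (mod n), and write u_b u_{b−1} ⋯ u_a for the product in Ũ_n over the cyclically descending word from b down to a. Then in Ũ_n: (u_b u_{b−1} ⋯ u_a)(u_b u_{b−1} ⋯ u_a) = (u_{b−1} u_{b−2} ⋯ u_a)(u_b u_{b−1} ⋯ u_a) = (u_b u_{b−1} ⋯ u_a)(u_b u_{b−1} ⋯ u_{a+1}), where for b = a the product u_{b−1} ⋯ u_a and the product u_b ⋯ u_{a+1} are interpreted as the empty product 1. -/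
open scoped BigOperators

/-- The cyclically descending word `(b, b-1, …, a)` of residues mod `n`, running downward
through the cyclic interval from `b` to `a`. -/
def descWT (n : ℕ) (b a : ZMod n) : List (ZMod n) :=
  (List.range ((b - a).val + 1)).map fun j => b - (j : ZMod n)

/-- The product in `Ũ_n` of the generators along a word of residues. -/
noncomputable def dProd (n : ℕ) (l : List (ZMod n)) : Groth n := (l.map (uGT n)).prod

lemma gd_descWT (n : ℕ) (b a : ZMod n) : descWT n b a =
    (List.range ((b - a).val + 1)).map fun j : ℕ => b - (j : ZMod n) := by
  simp only [descWT, List.pure_def, List.bind_eq_flatMap, ← List.map_eq_flatMap, List.map_map]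
  rfl

lemma gd_comm {M : Type*} [Monoid M] (v : ℕ → M) (m : ℕ)
    (hc : ∀ i j, i + 2 ≤ j → j ≤ m → v i * v j = v j * v i) (k j : ℕ) (hk : k + 1 ≤ j) (hj : j ≤ m) :
    ((List.range k).map v).prod * v j = v j * ((List.range k).map v).prod := by
  induction k with
  | zero => simp
  | succ k ih =>
    rw [List.range_succ, List.map_append, List.prod_append]
    simp only [List.map_cons, List.map_nil, List.prod_cons, List.prod_nil, mul_one]
    rw [mul_assoc, hc k j (by omega) hj, ← mul_assoc, ih (by omega), mul_assoc]

lemma gd_shift {M : Type*} [Monoid M] (v : ℕ → M) (m : ℕ)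
    (hb : ∀ i, i + 1 ≤ m → v i * v (i + 1) * v i = v (i + 1) * v i * v (i + 1))
    (hc : ∀ i j, i + 2 ≤ j → j ≤ m → v i * v j = v j * v i) (i k : ℕ) (hk : i + 2 ≤ k)
    (hkm : k ≤ m + 1) :
    ((List.range k).map v).prod * v i = v (i + 1) * ((List.range k).map v).prod := by
  induction k, hk using Nat.le_induction with
  | base =>
    rw [List.prod_range_succ, List.prod_range_succ]
    calc _ = ((List.range i).map v).prod * (v i * v (i + 1) * v i) := by simp only [mul_assoc]
      _ = (((List.range i).map v).prod * v (i + 1)) * v i * v (i + 1) := by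
        rw [hb i (by omega)]; simp only [mul_assoc]
      _ = _ := by rw [gd_comm v m hc i (i + 1) le_rfl (by omega)]; simp only [mul_assoc]
  | succ k hk ih =>
    rw [List.prod_range_succ, mul_assoc, ← hc i k hk (by omega), ← mul_assoc, ih (by omega), mul_assoc]

lemma gd_conj {M : Type*} [Monoid M] (v : ℕ → M) (m : ℕ)
    (hb : ∀ i, i + 1 ≤ m → v i * v (i + 1) * v i = v (i + 1) * v i * v (i + 1))
    (hc : ∀ i j, i + 2 ≤ j → j ≤ m → v i * v j = v j * v i) (k : ℕ) (hk : k ≤ m) :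
    ((List.range (m + 1)).map v).prod * ((List.range k).map v).prod =
      ((List.range k).map fun j => v (j + 1)).prod * ((List.range (m + 1)).map v).prod := by
  induction k with
  | zero => simp
  | succ k ih =>
    rw [List.prod_range_succ v k, List.prod_range_succ (fun j => v (j + 1)) k, ← mul_assoc,
      ih (by omega), mul_assoc, gd_shift v m hb hc k (m + 1) (by omega) le_rfl, mul_assoc]

lemma gd_main {M : Type*} [Monoid M] (v : ℕ → M) (m : ℕ) (hs : ∀ i, v i * v i = v i)
    (hb : ∀ i, i + 1 ≤ m → v i * v (i + 1) * v i = v (i + 1) * v i * v (i + 1))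
    (hc : ∀ i j, i + 2 ≤ j → j ≤ m → v i * v j = v j * v i) :
    ((List.range (m + 1)).map v).prod * ((List.range (m + 1)).map v).prod =
      ((List.range m).map fun j => v (j + 1)).prod * ((List.range (m + 1)).map v).prod := by
  conv_lhs => rw [List.prod_range_succ v m]
  rw [← List.prod_range_succ v m]
  conv_lhs => rw [List.prod_range_succ v m, ← mul_assoc, ← List.prod_range_succ v m]
  rw [gd_conj v m hb hc m le_rfl, mul_assoc]
  congr 1
  rw [List.prod_range_succ, mul_assoc, hs]

/-- In `Ũ_n`, for residues `a ≢ b + 1 (mod n)`, writing `P = u_b u_{b-1} ⋯ u_a` for the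
product over the cyclically descending word from `b` to `a`, one has
`P · P = (u_{b-1} ⋯ u_a) · P = P · (u_b ⋯ u_{a+1})`, where for `b = a` the products
`u_{b-1} ⋯ u_a` and `u_b ⋯ u_{a+1}` are interpreted as the empty product `1`. -/
theorem groth_desc_squared (n : ℕ) (hn : 3 ≤ n) (a b : ZMod n) (hab : a ≠ b + 1) :
    dProd n (descWT n b a) * dProd n (descWT n b a) =
      (if b = a then 1 else dProd n (descWT n (b - 1) a)) * dProd n (descWT n b a) ∧
    dProd n (descWT n b a) * dProd n (descWT n b a) =
      dProd n (descWT n b a) * (if b = a then 1 else dProd n (descWT n b (a + 1))) := by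
  have : NeZero n := ⟨by omega⟩
  obtain ⟨m, hm⟩ : ∃ m, m = (b - a).val := ⟨_, rfl⟩
  have hmc : (m : ZMod n) = b - a := by rw [hm, ZMod.natCast_zmod_val]
  have hmn : m + 2 ≤ n := by
    have h1 : m < n := hm ▸ ZMod.val_lt _
    by_contra h
    have h2 : m + 1 = n := by omega
    apply hab
    have h3 : ((m + 1 : ℕ) : ZMod n) = 0 := by rw [h2]; simp
    push_cast at h3
    rw [hmc] at h3
    linear_combination -h3
  let v : ℕ → Groth n := fun j => uGT n (b - (j : ZMod n))
  have hs : ∀ i, v i * v i = v i := fun i => by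
    have := RingQuot.mkAlgHom_rel ℂ (GrothRel.sq (b - (i : ZMod n)))
    simpa [v, uGT] using this
  have hb : ∀ i, i + 1 ≤ m → v i * v (i + 1) * v i = v (i + 1) * v i * v (i + 1) := fun i _ => by
    have := RingQuot.mkAlgHom_rel ℂ (GrothRel.braid (b - ((i + 1 : ℕ) : ZMod n)))
    have e : b - ((i + 1 : ℕ) : ZMod n) + 1 = b - (i : ZMod n) := by push_cast; ring
    rw [e] at this
    simp only [map_mul] at this
    exact this.symm
  have key : ∀ d : ℕ, 0 < d → d < n → (d : ZMod n) ≠ 0 := fun d h0 h1 h => by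
    rw [ZMod.natCast_eq_zero_iff] at h
    exact absurd (Nat.le_of_dvd h0 h) (by omega)
  have hc : ∀ i j, i + 2 ≤ j → j ≤ m → v i * v j = v j * v i := fun i j hij hj => by
    obtain ⟨d, rfl⟩ := Nat.exists_eq_add_of_le hij
    have := RingQuot.mkAlgHom_rel ℂ (GrothRel.comm (b - (i : ZMod n))
      (b - ((i + 2 + d : ℕ) : ZMod n)) ?_ ?_)
    · simp only [map_mul] at this
      exact this
    · intro h
      apply key (d + 1) (by omega) (by omega)
      push_cast at h ⊢
      linear_combination h
    · intro h
      apply key (d + 3) (by omega) (by omega)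
      push_cast at h ⊢
      linear_combination -h
  have hP : dProd n (descWT n b a) = ((List.range (m + 1)).map v).prod := by
    rw [dProd, gd_descWT, ← hm, List.map_map]; rfl
  have hval : b ≠ a → ∀ x : ZMod n, x = b - a - 1 → x.val + 1 = m := fun hne x hx => by
    have h0 : m ≠ 0 := fun h => hne (by
      rw [h] at hmc; push_cast at hmc; linear_combination -hmc)
    obtain ⟨k, rfl⟩ := Nat.exists_eq_succ_of_ne_zero h0
    have : x = (k : ZMod n) := by
      rw [hx, ← hmc]; push_cast; ring
    rw [this, ZMod.val_natCast_of_lt (by omega)]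
  have hm0 : b = a → m = 0 := fun h => by rw [hm, h]; simp
  have hQ : (if b = a then 1 else dProd n (descWT n (b - 1) a)) =
      ((List.range m).map fun j => v (j + 1)).prod := by
    split_ifs with h
    · rw [hm0 h]; simp
    · rw [dProd, gd_descWT, hval h _ (by ring), List.map_map]
      congr 1
      apply List.map_congr_left
      intro j _
      simp only [v, Function.comp]
      congr 1
      push_cast; ring
  have hR : (if b = a then 1 else dProd n (descWT n b (a + 1))) =
      ((List.range m).map v).prod := by
    split_ifs with h
    · rw [hm0 h]; simp
    · rw [dProd, gd_descWT, hval h _ (by ring), List.map_map]; rfl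
  rw [hQ, hR, hP]
  refine ⟨gd_main v m hs hb hc, ?_⟩
  rw [gd_conj v m hb hc m le_rfl]
  exact gd_main v m hs hb hc
end
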